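/- arXiv:1510.06833 — 3 statements merged into one kernel-verified Lean document; each statement's English description precedes it below -/
import Mathlib

section
/- Fix n ≥ 1, 1 ≤ r ≤ n, and 0 < α ≤ 2. Let X be a centered homogeneous Gaussian field on ℝ^n with covariance r satisfying r(t) = 1 − ‖t‖^α + o(‖t‖^α) as ‖t‖ → 0, let M_1,…,M_n be an orthonormal basis of ℝ^n, let l be a positive integer and γ > 0. For x > 0 set G_x = {∑_{k=1}^n i_k γ x^{-2/α} M_k : i_k ∈ {0,1,…,l} for 1 ≤ k ≤ r, i_k = 0 for r < k ≤ n}. Then lim_{x→∞} P(max_{t ∈ G_x} X(t) > x)/Ψ(x) = H_α(C^r(l,γ)), and likewise lim_{x→∞} P(min_{t ∈ G_x} X(t) < −x)/Ψ(x) = H_α(C^r(l,γ)). -/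
open MeasureTheory ProbabilityTheory Real Filter Asymptotics
open scoped Topology NNReal

/-- A family `(X t)_{t ∈ ι}` of real random variables is a Gaussian process: every finite
real linear combination has a (possibly degenerate) Gaussian distribution. -/
def IsGaussianFamily {Ω : Type*} [MeasurableSpace Ω] (P : Measure Ω)
    {ι : Type*} (X : ι → Ω → ℝ) : Prop :=
  ∀ (N : ℕ) (c : Fin N → ℝ) (ts : Fin N → ι), ∃ (m : ℝ) (v : ℝ≥0),
    Measure.map (fun ω => ∑ i, c i * X (ts i) ω) P = gaussianReal m v

/-- A centered homogeneous Gaussian field on `ℝ^n` with covariance function `r`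
(`r 0 = 1`): a Gaussian process with continuous sample paths, mean zero, and
`E[X(t+s)X(s)] = r(t)`. -/
structure IsHomogGaussianField {Ω : Type*} [MeasurableSpace Ω] (P : Measure Ω) {n : ℕ}
    (X : EuclideanSpace ℝ (Fin n) → Ω → ℝ) (r : EuclideanSpace ℝ (Fin n) → ℝ) : Prop where
  gaussian : IsGaussianFamily P X
  meas : ∀ t, Measurable (X t)
  cont : ∀ ω, Continuous fun t => X t ω
  mean : ∀ t, ∫ ω, X t ω ∂P = 0
  cov : ∀ t s, ∫ ω, X (t + s) ω * X s ω ∂P = r t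
  var_one : r 0 = 1

/-- The field `χ_α` on `ℝ^n`: a Gaussian process with continuous sample paths, mean
`E[χ_α(t)] = −‖t‖^α` and covariance `Cov(χ_α(t), χ_α(s)) = ‖t‖^α + ‖s‖^α − ‖t−s‖^α`. -/
structure IsChiAlpha {Ω' : Type*} [MeasurableSpace Ω'] (P' : Measure Ω') {n : ℕ}
    (α : ℝ) (χ : EuclideanSpace ℝ (Fin n) → Ω' → ℝ) : Prop where
  gaussian : IsGaussianFamily P' χ
  meas : ∀ t, Measurable (χ t)
  cont : ∀ ω, Continuous fun t => χ t ω
  mean : ∀ t, ∫ ω, χ t ω ∂P' = -‖t‖ ^ α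
  cov : ∀ t s, (∫ ω, χ t ω * χ s ω ∂P') - (∫ ω, χ t ω ∂P') * (∫ ω, χ s ω ∂P')
      = ‖t‖ ^ α + ‖s‖ ^ α - ‖t - s‖ ^ α

/-- `H_α(T) = E[exp(sup_{t∈T} χ_α(t))]`. -/
noncomputable def HalphaSet {Ω' : Type*} [MeasurableSpace Ω'] (P' : Measure Ω')
    {n : ℕ} (χ : EuclideanSpace ℝ (Fin n) → Ω' → ℝ)
    (T : Set (EuclideanSpace ℝ (Fin n))) : ℝ :=
  ∫ ω, Real.exp (sSup ((fun t => χ t ω) '' T)) ∂P'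

/-- The standard normal density `φ(u) = (2π)^{-1/2} e^{-u²/2}`. -/
noncomputable def stdGaussianPDF (u : ℝ) : ℝ :=
  (2 * Real.pi) ^ (-(1/2) : ℝ) * Real.exp (-u ^ 2 / 2)

/-- `Ψ(u) = φ(u)/u`. -/
noncomputable def PsiFn (u : ℝ) : ℝ := stdGaussianPDF u / u


/-- The set `C^r(l,γ) = {γt : t_i ∈ {0,1,…,l} for 1 ≤ i ≤ r, t_i = 0 for r < i ≤ n}`
inside `ℝ^n`. -/
def CrSet (n rr l : ℕ) (γ : ℝ) : Set (EuclideanSpace ℝ (Fin n)) :=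
  {t | ∀ k : Fin n, if (k : ℕ) < rr then ∃ m : ℕ, m ≤ l ∧ t k = γ * m else t k = 0}


lemma IsGaussianFamily.hasGaussianLaw {Ω ι κ : Type*} [MeasurableSpace Ω] {P : Measure Ω}
    [Fintype κ] {X : ι → Ω → ℝ} (hX : IsGaussianFamily P X) (hm : ∀ t, Measurable (X t))
    (t : κ → ι) : HasGaussianLaw (fun ω k => X (t k) ω) P := by
  classical
  refine ⟨isGaussian_of_map_eq_gaussianReal fun L => ?_⟩
  let e := Fintype.equivFin κ
  obtain ⟨m, v, h⟩ := hX (Fintype.card κ) (fun k => L (Pi.single (e.symm k) 1))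
    (fun k => t (e.symm k))
  refine ⟨m, v, ?_⟩
  rw [Measure.map_map L.continuous.measurable (measurable_pi_lambda _ fun k => hm (t k)), ← h]
  congr 1
  ext ω
  rw [Function.comp_apply, Equiv.sum_comp e.symm
    (fun k : κ => L (Pi.single k 1) * X (t k) ω)]
  conv_lhs => rw [pi_eq_sum_univ' fun k => X (t k) ω]
  simp [map_sum, mul_comm]

lemma integral_exp_mul_measureReal_lt {Ω : Type*} [MeasurableSpace Ω] (P : Measure Ω)
    [IsFiniteMeasure P] {S : Ω → ℝ} (hS : Measurable S) :
    ∫ w, exp w * P.real {ω | w < S ω} = ∫ ω, exp (S ω) ∂P := by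
  have hmeas : Measurable fun w => P.real {ω | w < S ω} := Antitone.measurable fun a b hab =>
    measureReal_mono fun ω (h : b < S ω) => hab.trans_lt h
  rw [integral_eq_lintegral_of_nonneg_ae (.of_forall fun w => by positivity)
    (by fun_prop),
    integral_eq_lintegral_of_nonneg_ae (.of_forall fun ω => (exp_pos _).le)
    (measurable_exp.comp hS).aestronglyMeasurable]
  congr 1
  have hset : MeasurableSet {p : ℝ × Ω | p.1 < S p.2} :=
    measurableSet_lt measurable_fst (hS.comp measurable_snd)
  calc ∫⁻ w, ENNReal.ofReal (exp w * P.real {ω | w < S ω})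
      = ∫⁻ w, ∫⁻ ω, {p : ℝ × Ω | p.1 < S p.2}.indicator
          (fun p => ENNReal.ofReal (exp p.1)) (w, ω) ∂P := by
        refine lintegral_congr fun w => ?_
        rw [ENNReal.ofReal_mul (exp_pos _).le, ofReal_measureReal,
          ← lintegral_indicator_const (measurableSet_lt measurable_const hS)]
        rfl
    _ = ∫⁻ ω, (∫⁻ w, {p : ℝ × Ω | p.1 < S p.2}.indicator
          (fun p => ENNReal.ofReal (exp p.1)) (w, ω)) ∂P :=
        lintegral_lintegral_swap
          (((measurable_exp.comp measurable_fst).ennreal_ofReal).indicator hset).aemeasurable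
    _ = ∫⁻ ω, ENNReal.ofReal (exp (S ω)) ∂P := by
        refine lintegral_congr fun ω => ?_
        rw [← integral_exp_Iic, integral_Iic_eq_integral_Iio, ofReal_integral_eq_lintegral_ofReal
          ((integrableOn_exp_Iic _).mono_set Set.Iio_subset_Iic_self)
          (.of_forall fun w => (exp_pos _).le), ← lintegral_indicator measurableSet_Iio]
        rfl

lemma measureReal_exists_lt_div_PsiFn {Ω ι : Type*} [MeasurableSpace Ω] {P : Measure Ω}
    [IsProbabilityMeasure P] [Finite ι] {W : Ω → ℝ} {Y : ι → Ω → ℝ}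
    (hW : Measurable W) (hY : ∀ i, Measurable (Y i)) (hWlaw : P.map W = gaussianReal 0 1)
    (hind : IndepFun W (fun ω i => Y i ω) P) (ρ : ι → ℝ) {x : ℝ} (hx : 0 < x) :
    P.real {ω | ∃ i, x < Y i ω + ρ i * W ω} / PsiFn x
      = ∫ w, exp (w - w ^ 2 / (2 * x ^ 2)) *
          P.real {ω | ∃ i, ρ i * w < x * Y i ω - x ^ 2 * (1 - ρ i)} := by
  have hYm : Measurable fun ω i => Y i ω := measurable_pi_lambda _ hY
  set ν := P.map fun ω i => Y i ω with hν
  have : IsProbabilityMeasure ν := Measure.isProbabilityMeasure_map hYm.aemeasurable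
  set A : Set (ℝ × (ι → ℝ)) := {p | ∃ i, x < p.2 i + ρ i * p.1} with hA
  have hAm : MeasurableSet A := by
    rw [hA, Set.ofPred_exists]
    exact .iUnion fun i => measurableSet_lt measurable_const (by fun_prop)
  have h1 : P.real {ω | ∃ i, x < Y i ω + ρ i * W ω}
      = ∫ u, gaussianPDFReal 0 1 u * P.real {ω | ∃ i, x < Y i ω + ρ i * u} := by
    have : P {ω | ∃ i, x < Y i ω + ρ i * W ω} = ((gaussianReal 0 1).prod ν) A := by
      rw [← hWlaw,
        ← (indepFun_iff_map_prod_eq_prod_map_map hW.aemeasurable hYm.aemeasurable).1 hind,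
        Measure.map_apply (hW.prodMk hYm) hAm]
      rfl
    rw [measureReal_def, this, Measure.prod_apply hAm, ← integral_toReal,
      integral_gaussianReal_eq_integral_smul (by simp)]
    · refine integral_congr_ae (.of_forall fun u => ?_)
      simp only [smul_eq_mul]
      rw [hν, Measure.map_apply hYm (measurable_prodMk_left hAm)]
      rfl
    · exact (measurable_measure_prodMk_left hAm).aemeasurable
    · exact .of_forall fun u => measure_lt_top _ _
  rw [h1]
  set g : ℝ → ℝ := fun u => gaussianPDFReal 0 1 u * P.real {ω | ∃ i, x < Y i ω + ρ i * u} with hg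
  have h2 : ∫ u, g u = x⁻¹ * ∫ w, g (x - x⁻¹ * w) := by
    rw [Measure.integral_comp_mul_left (fun v => g (x - v)), integral_sub_left_eq_self g volume x]
    simp [abs_of_pos hx, hx.ne']
  rw [h2, mul_div_assoc, ← integral_div, ← integral_const_mul]
  refine integral_congr_ae (.of_forall fun w => ?_)
  have hset : {ω | ∃ i, x < Y i ω + ρ i * (x - x⁻¹ * w)}
      = {ω | ∃ i, ρ i * w < x * Y i ω - x ^ 2 * (1 - ρ i)} := by
    ext ω
    refine exists_congr fun i => ?_
    rw [← mul_lt_mul_iff_right₀ hx, ← sub_pos, ← sub_pos (b := ρ i * w)]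
    field_simp
    ring_nf
  have hexp : exp (w - w ^ 2 / (2 * x ^ 2)) * exp (-x ^ 2 / 2) =
      exp (-(x - x⁻¹ * w) ^ 2 / 2) := by
    rw [← exp_add]; congr 1; field_simp; ring
  simp only [hg, hset, PsiFn, stdGaussianPDF, gaussianPDFReal]
  rw [rpow_neg (by positivity), ← sqrt_eq_rpow]
  simp only [NNReal.coe_one, mul_one, sub_zero]
  rw [← hexp]
  have := exp_pos (-x ^ 2 / 2)
  field_simp

lemma ProbabilityTheory.HasGaussianLaw.fun_add_const {Ω E : Type*} [MeasurableSpace Ω]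
    {P : Measure Ω} [NormedAddCommGroup E] [NormedSpace ℝ E] [MeasurableSpace E] [BorelSpace E]
    [CompleteSpace E] [SecondCountableTopology E] {X : Ω → E}
    (hX : HasGaussianLaw X P) (c : E) : HasGaussianLaw (fun ω => X ω + c) P where
  isGaussian_map := by
    have := hX.isGaussian_map
    have h : P.map (fun ω => X ω + c) = (P.map X).map (· + c) :=
      (AEMeasurable.map_map_of_aemeasurable (g := (· + c)) (by fun_prop) hX.aemeasurable).symm
    rw [h]
    infer_instance

section Convergence

variable {Ω Ω' ι : Type*} [MeasurableSpace Ω] {P : Measure Ω} [IsProbabilityMeasure P]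
  [MeasurableSpace Ω'] {P' : Measure Ω'} [IsProbabilityMeasure P'] [Fintype ι]
  {Z : ℕ → ι → Ω → ℝ} {V : ι → Ω' → ℝ}

lemma ProbabilityTheory.HasGaussianLaw.charFun_map_toLp {U : ι → Ω → ℝ}
    (hU : HasGaussianLaw (fun ω i => U i ω) P) (t : EuclideanSpace ℝ ι) :
    charFun (P.map fun ω => WithLp.toLp 2 fun i => U i ω) t =
      Complex.exp (((∑ i, t i * ∫ ω, U i ω ∂P : ℝ) : ℂ) * Complex.I
        - ((∑ i, ∑ j, t i * (t j * cov[U i, U j; P]) : ℝ) : ℂ) / 2) := by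
  have hLp : ∀ i, MemLp (fun ω => t i * U i ω) 2 P := fun i => (hU.eval i).memLp_two.const_mul _
  have hin : (fun ω => inner ℝ t (WithLp.toLp 2 fun i => U i ω)) = fun ω => ∑ i, t i * U i ω := by
    ext ω
    simp [PiLp.inner_apply, mul_comm]
  rw [(hU.toLp_pi 2).charFun_map_eq, hin, integral_finsetSum _ fun i _ => (hLp i).integrable
    (by norm_num), ← covariance_self (memLp_finsetSum _ fun i _ => hLp i).aemeasurable,
    covariance_fun_sum_fun_sum hLp hLp]
  simp_rw [integral_const_mul, covariance_const_mul_left, covariance_const_mul_right]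

lemma tendsto_charFun_map_toLp
    (hZ : ∀ n, HasGaussianLaw (fun ω i => Z n i ω) P) (hV : HasGaussianLaw (fun ω i => V i ω) P')
    (hmean : ∀ i, Tendsto (fun n => ∫ ω, Z n i ω ∂P) atTop (𝓝 (∫ ω, V i ω ∂P')))
    (hcov : ∀ i j, Tendsto (fun n => cov[Z n i, Z n j; P]) atTop (𝓝 cov[V i, V j; P']))
    (t : EuclideanSpace ℝ ι) :
    Tendsto (fun n => charFun (P.map fun ω => WithLp.toLp 2 fun i => Z n i ω) t) atTop
      (𝓝 (charFun (P'.map fun ω => WithLp.toLp 2 fun i => V i ω) t)) := by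
  simp_rw [fun n => (hZ n).charFun_map_toLp t, hV.charFun_map_toLp t]
  refine (Complex.continuous_exp.tendsto _).comp (.sub (.mul_const _ ?_) (.div_const ?_ _))
  · exact (Complex.continuous_ofReal.tendsto _).comp
      (tendsto_finsetSum _ fun i _ => (hmean i).const_mul _)
  · exact (Complex.continuous_ofReal.tendsto _).comp (tendsto_finsetSum _ fun i _ =>
      tendsto_finsetSum _ fun j _ => ((hcov i j).const_mul _).const_mul _)

lemma tendsto_measureReal_exists_lt
    (hZ : ∀ n, HasGaussianLaw (fun ω i => Z n i ω) P) (hV : HasGaussianLaw (fun ω i => V i ω) P')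
    (hmean : ∀ i, Tendsto (fun n => ∫ ω, Z n i ω ∂P) atTop (𝓝 (∫ ω, V i ω ∂P')))
    (hcov : ∀ i j, Tendsto (fun n => cov[Z n i, Z n j; P]) atTop (𝓝 cov[V i, V j; P']))
    {w : ℝ} (hw : ∀ i, P' {ω | V i ω = w} = 0) :
    Tendsto (fun n => P.real {ω | ∃ i, w < Z n i ω}) atTop (𝓝 (P'.real {ω | ∃ i, w < V i ω})) := by
  have hZm : ∀ n, AEMeasurable (fun ω => WithLp.toLp 2 fun i => Z n i ω) P := fun n =>
    ((hZ n).toLp_pi 2).aemeasurable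
  have hVm : AEMeasurable (fun ω => WithLp.toLp 2 fun i => V i ω) P' := (hV.toLp_pi 2).aemeasurable
  let μs : ℕ → ProbabilityMeasure (EuclideanSpace ℝ ι) := fun n =>
    ⟨P.map fun ω => WithLp.toLp 2 fun i => Z n i ω, Measure.isProbabilityMeasure_map (hZm n)⟩
  let μ : ProbabilityMeasure (EuclideanSpace ℝ ι) :=
    ⟨P'.map fun ω => WithLp.toLp 2 fun i => V i ω, Measure.isProbabilityMeasure_map hVm⟩
  have hlim : Tendsto μs atTop (𝓝 μ) :=
    ProbabilityMeasure.tendsto_of_tendsto_charFun (tendsto_charFun_map_toLp hZ hV hmean hcov)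
  set E : Set (EuclideanSpace ℝ ι) := {z | ∃ i, w < z i} with hE
  have hEo : IsOpen E := by
    rw [hE, Set.ofPred_exists]
    exact isOpen_iUnion fun i => isOpen_lt continuous_const (by fun_prop)
  have hEc : closure E ⊆ {z | ∃ i, w ≤ z i} := by
    refine closure_minimal (fun z ⟨i, hi⟩ => ⟨i, hi.le⟩) ?_
    rw [Set.ofPred_exists]
    exact isClosed_iUnion_of_finite fun i => isClosed_le continuous_const (by fun_prop)
  have hfr : (μ : Measure (EuclideanSpace ℝ ι)) (frontier E) = 0 := by
    refine measure_mono_null (t := ⋃ i, {z | z i = w}) (fun z hz => ?_) ?_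
    · rw [hEo.frontier_eq] at hz
      obtain ⟨i, hi⟩ := hEc hz.1
      exact Set.mem_iUnion.2 ⟨i, le_antisymm (not_lt.1 fun h => hz.2 ⟨i, h⟩) hi⟩
    · refine measure_iUnion_null fun i => ?_
      change P'.map _ _ = 0
      rw [Measure.map_apply_of_aemeasurable hVm
        (measurableSet_eq_fun (by fun_prop) measurable_const)]
      exact hw i
  have h := (ENNReal.tendsto_toReal (measure_ne_top _ _)).comp
    (ProbabilityMeasure.tendsto_measure_of_null_frontier_of_tendsto' hlim hfr)
  convert h using 2
  · rename_i n
    change _ = (P.map _ _).toReal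
    rw [Measure.map_apply_of_aemeasurable (hZm n) hEo.measurableSet]
    rfl
  · change _ = (P'.map _ _).toReal
    rw [Measure.map_apply_of_aemeasurable hVm hEo.measurableSet]
    rfl

lemma measureReal_exists_lt_le (Z : ι → Ω → ℝ) (hZ : HasGaussianLaw (fun ω i => Z i ω) P)
    {ρ : ι → ℝ} (hρ : ∀ i, 1 / 2 ≤ ρ i) {w : ℝ} (hw : 0 ≤ w) :
    P.real {ω | ∃ i, ρ i * w < Z i ω} ≤
      exp (-2 * w) * ∑ i, exp ((∫ ω, Z i ω ∂P) * 4 + cov[Z i, Z i; P] * 4 ^ 2 / 2) := by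
  have hsub : {ω | ∃ i, ρ i * w < Z i ω} ⊆ ⋃ i, {ω | w / 2 ≤ Z i ω} := fun ω ⟨i, hi⟩ =>
    Set.mem_iUnion.2 ⟨i, by simp only [Set.mem_ofPred_eq]; nlinarith [hρ i]⟩
  refine (measureReal_mono hsub).trans ((measureReal_iUnion_fintype_le _).trans ?_)
  rw [Finset.mul_sum]
  refine Finset.sum_le_sum fun i _ => ?_
  have hlaw := (hZ.eval i).map_eq_gaussianReal
  have hint : Integrable (fun ω => exp (4 * Z i ω)) P := by
    have := integrable_exp_mul_gaussianReal (μ := P[Z i]) (v := Var[Z i; P].toNNReal) 4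
    rw [← hlaw] at this
    exact this.comp_aemeasurable (hZ.eval i).aemeasurable
  refine (measure_ge_le_exp_mul_mgf (w / 2) (by norm_num) hint).trans_eq ?_
  rw [mgf_gaussianReal hlaw, covariance_self (hZ.eval i).aemeasurable,
    Real.coe_toNNReal _ (variance_nonneg _ _)]
  congr 2
  ring

lemma integrable_exp_neg_abs : Integrable fun w : ℝ => exp (-|w|) := by
  rw [← integrableOn_univ, ← Set.Iic_union_Ioi (a := (0 : ℝ))]
  refine .union ((integrableOn_exp_Iic 0).congr_fun (fun w hw => ?_) measurableSet_Iic)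
    ((integrableOn_exp_neg_Ioi 0).congr_fun (fun w hw => ?_) measurableSet_Ioi)
  · simp [abs_of_nonpos (Set.mem_Iic.1 hw)]
  · simp [abs_of_pos (Set.mem_Ioi.1 hw)]

lemma tendsto_integral_exp_mul_measureReal_exists_lt [Nonempty ι]
    (hZm : ∀ n i, Measurable (Z n i)) (hVm : ∀ i, Measurable (V i))
    (hZ : ∀ n, HasGaussianLaw (fun ω i => Z n i ω) P) (hV : HasGaussianLaw (fun ω i => V i ω) P')
    (hmean : ∀ i, Tendsto (fun n => ∫ ω, Z n i ω ∂P) atTop (𝓝 (∫ ω, V i ω ∂P')))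
    (hcov : ∀ i j, Tendsto (fun n => cov[Z n i, Z n j; P]) atTop (𝓝 cov[V i, V j; P']))
    {ρ : ℕ → ι → ℝ} (hρ : ∀ i, Tendsto (fun n => ρ n i) atTop (𝓝 1))
    {x : ℕ → ℝ} (hx : Tendsto x atTop atTop) :
    Tendsto (fun n => ∫ w, exp (w - w ^ 2 / (2 * x n ^ 2)) * P.real {ω | ∃ i, ρ n i * w < Z n i ω})
      atTop (𝓝 (∫ ω, exp (⨆ i, V i ω) ∂P')) := by
  have hS : Measurable fun ω => ⨆ i, V i ω := Measurable.iSup hVm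
  rw [← integral_exp_mul_measureReal_lt P' hS]
  set K : ℕ → ℝ := fun n =>
    ∑ i, exp ((∫ ω, Z n i ω ∂P) * 4 + cov[Z n i, Z n i; P] * 4 ^ 2 / 2) with hK
  obtain ⟨C, hC⟩ : ∃ C, ∀ᶠ n in atTop, K n ≤ C := by
    have : Tendsto K atTop (𝓝 (∑ i, exp ((∫ ω, V i ω ∂P') * 4 + cov[V i, V i; P'] * 4 ^ 2 / 2))) :=
      tendsto_finsetSum _ fun i _ => (continuous_exp.tendsto _).comp
        (((hmean i).mul_const _).add (((hcov i i).mul_const _).div_const _))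
    exact ⟨_, this.eventually_le_const (lt_add_one _)⟩
  have hρ' : ∀ᶠ n in atTop, ∀ i, 1 / 2 ≤ ρ n i :=
    eventually_all.2 fun i => (hρ i).eventually_const_le (by norm_num)
  refine tendsto_integral_filter_of_dominated_convergence (fun w => (1 + |C|) * exp (-|w|))
    (.of_forall fun n => ?_) ?_ (integrable_exp_neg_abs.const_mul _) ?_
  · have hset : MeasurableSet {p : ℝ × Ω | ∃ i, ρ n i * p.1 < Z n i p.2} := by
      rw [Set.ofPred_exists]
      exact .iUnion fun i => measurableSet_lt (by fun_prop) ((hZm n i).comp measurable_snd)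
    have : Measurable fun w => P.real {ω | ∃ i, ρ n i * w < Z n i ω} :=
      (measurable_measure_prodMk_left hset).ennreal_toReal
    fun_prop
  · filter_upwards [hC, hρ'] with n hCn hρn
    refine .of_forall fun w => ?_
    rw [norm_of_nonneg (by positivity)]
    have hle : exp (w - w ^ 2 / (2 * x n ^ 2)) ≤ exp w := exp_le_exp.2 (by
      have : 0 ≤ w ^ 2 / (2 * x n ^ 2) := by positivity
      linarith)
    rcases le_total w 0 with hw | hw
    · rw [abs_of_nonpos hw, neg_neg, mul_comm]
      gcongr
      exact measureReal_le_one.trans (le_add_of_nonneg_right (abs_nonneg _))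
    · calc _ ≤ exp w * (exp (-2 * w) * K n) :=
            mul_le_mul hle (measureReal_exists_lt_le _ (hZ n) hρn hw) (by positivity)
              (by positivity)
        _ = K n * exp (-|w|) := by
            rw [abs_of_nonneg hw, ← mul_assoc, ← exp_add, mul_comm]; ring_nf
        _ ≤ _ := by
            gcongr
            linarith [le_abs_self C]
  · have hcount : ∀ᵐ w : ℝ, ∀ i, P' {ω | V i ω = w} = 0 := ae_all_iff.2 fun i => by
      filter_upwards [(Measure.countable_meas_level_set_pos (μ := P') (hVm i)).ae_notMem volume]
        with w hw
      simpa using hw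
    filter_upwards [hcount] with w hw
    have hset : {ω | w < ⨆ i, V i ω} = {ω | ∃ i, w < V i ω} := by
      ext ω
      exact lt_ciSup_iff (Set.finite_range fun i => V i ω).bddAbove
    rw [hset]
    have h1 : Tendsto (fun n => w - w ^ 2 / (2 * x n ^ 2)) atTop (𝓝 w) := by
      have : Tendsto (fun n => 2 * x n ^ 2) atTop atTop :=
        ((tendsto_pow_atTop two_ne_zero).comp hx).const_mul_atTop two_pos
      simpa using tendsto_const_nhds.sub (this.const_div_atTop (w ^ 2))
    refine ((continuous_exp.tendsto _).comp h1).mul ?_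
    have hsh : ∀ n, {ω | ∃ i, ρ n i * w < Z n i ω}
        = {ω | ∃ i, w < Z n i ω + (1 - ρ n i) * w} := fun n => by
      ext ω
      refine exists_congr fun i => ?_
      rw [← sub_pos, ← sub_pos (b := w)]
      ring_nf
    simp_rw [hsh]
    refine tendsto_measureReal_exists_lt (Z := fun n i ω => Z n i ω + (1 - ρ n i) * w)
      (fun n => (hZ n).fun_add_const fun i => (1 - ρ n i) * w) hV (fun i => ?_) (fun i j => ?_) hw
    · have hint : ∀ n, ∫ ω, (Z n i ω + (1 - ρ n i) * w) ∂P
          = ∫ ω, Z n i ω ∂P + (1 - ρ n i) * w := fun n => by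
        rw [integral_add ((hZ n).eval i).integrable (integrable_const _)]
        simp
      simp_rw [hint]
      simpa using (hmean i).add (((hρ i).const_sub 1).mul_const w)
    · refine (hcov i j).congr fun n => ?_
      rw [covariance_add_const_left ((hZ n).eval i).integrable,
        covariance_add_const_right ((hZ n).eval j).integrable]

end Convergence

namespace IsHomogGaussianField

variable {Ω : Type*} [MeasurableSpace Ω] {P : Measure Ω} {n : ℕ}
  {X : EuclideanSpace ℝ (Fin n) → Ω → ℝ} {r : EuclideanSpace ℝ (Fin n) → ℝ}

lemma neg (hX : IsHomogGaussianField P X r) : IsHomogGaussianField P (fun t ω => -X t ω) r where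
  gaussian N c ts := by simpa using hX.gaussian N (fun i => -c i) ts
  meas t := (hX.meas t).neg
  cont ω := (hX.cont ω).neg
  mean t := by simp [integral_neg, hX.mean]
  cov t s := by simpa using hX.cov t s
  var_one := hX.var_one

lemma memLp (hX : IsHomogGaussianField P X r) (t : EuclideanSpace ℝ (Fin n)) :
    MemLp (X t) 2 P :=
  ((hX.gaussian.hasGaussianLaw hX.meas fun _ : Unit => t).eval ()).memLp_two

lemma hasGaussianLaw_residual {ι : Type*} [Fintype ι] (hX : IsHomogGaussianField P X r)
    (t : ι → EuclideanSpace ℝ (Fin n)) (ρ : ι → ℝ) :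
    HasGaussianLaw
      (fun ω => ((fun _ => X 0 ω : Unit → ℝ), fun i => X (t i) ω - ρ i * X 0 ω)) P := by
  let pr (k : Option ι) : (Option ι → ℝ) →L[ℝ] ℝ := ContinuousLinearMap.proj (R := ℝ) k
  let L : (Option ι → ℝ) →L[ℝ] (Unit → ℝ) × (ι → ℝ) :=
    (ContinuousLinearMap.pi fun _ => pr none).prod
      (ContinuousLinearMap.pi fun i => pr (some i) - ρ i • pr none)
  exact (hX.gaussian.hasGaussianLaw hX.meas fun k : Option ι => k.elim 0 t).map_fun L

variable [IsProbabilityMeasure P]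

lemma covariance_eq (hX : IsHomogGaussianField P X r) (t s : EuclideanSpace ℝ (Fin n)) :
    cov[X t, X s; P] = r (t - s) := by
  rw [covariance_eq_sub (hX.memLp t) (hX.memLp s), hX.mean, hX.mean, ← hX.cov (t - s) s,
    sub_add_cancel]
  simp

lemma cov_neg (hX : IsHomogGaussianField P X r) (t : EuclideanSpace ℝ (Fin n)) :
    r (-t) = r t := by
  rw [← zero_sub, ← hX.covariance_eq, covariance_comm, hX.covariance_eq, sub_zero]

lemma map_zero (hX : IsHomogGaussianField P X r) : P.map (X 0) = gaussianReal 0 1 := by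
  have h := (hX.gaussian.hasGaussianLaw hX.meas fun _ : Unit => 0).eval ()
  rw [h.map_eq_gaussianReal, hX.mean, ← covariance_self (hX.meas 0).aemeasurable,
    hX.covariance_eq, sub_zero, hX.var_one, Real.toNNReal_one]

lemma covariance_residual (hX : IsHomogGaussianField P X r) (t s : EuclideanSpace ℝ (Fin n)) :
    cov[fun ω => X t ω - r t * X 0 ω, fun ω => X s ω - r s * X 0 ω; P]
      = r (t - s) - r t * r s := by
  have ht := hX.memLp t
  have hs := hX.memLp s
  have h0 := hX.memLp 0
  have hres : MemLp (fun ω => X s ω - r s * X 0 ω) 2 P := hs.sub (h0.const_mul _)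
  rw [covariance_fun_sub_left ht (h0.const_mul _) hres,
    covariance_fun_sub_right ht hs (h0.const_mul _),
    covariance_fun_sub_right (h0.const_mul _) hs (h0.const_mul _)]
  simp only [covariance_const_mul_left, covariance_const_mul_right, hX.covariance_eq, sub_zero,
    zero_sub, hX.cov_neg, hX.var_one]
  ring

lemma indepFun_residual {ι : Type*} [Fintype ι] (hX : IsHomogGaussianField P X r)
    (t : ι → EuclideanSpace ℝ (Fin n)) :
    IndepFun (X 0) (fun ω i => X (t i) ω - r (t i) * X 0 ω) P := by
  have h := (hX.hasGaussianLaw_residual t fun i => r (t i)).indepFun_of_covariance_eval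
    (X := fun _ => X 0) (Y := fun i ω => X (t i) ω - r (t i) * X 0 ω) fun _ i => by
      have h0 := hX.memLp 0
      rw [covariance_fun_sub_right h0 (hX.memLp _) (h0.const_mul _), covariance_const_mul_right]
      simp [hX.covariance_eq, hX.cov_neg, hX.var_one]
  exact h.comp (φ := fun f : Unit → ℝ => f ()) (measurable_pi_apply ()) measurable_id

end IsHomogGaussianField

lemma tendsto_sq_mul_one_sub {n : ℕ} {r : EuclideanSpace ℝ (Fin n) → ℝ} {α : ℝ} (hα : 0 < α)
    (hr : (fun t => r t - (1 - ‖t‖ ^ α)) =o[𝓝 0] fun t => ‖t‖ ^ α)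
    (p : EuclideanSpace ℝ (Fin n)) :
    Tendsto (fun x : ℝ => x ^ 2 * (1 - r (x ^ (-2 / α) • p))) atTop (𝓝 (‖p‖ ^ α)) := by
  have hscale : Tendsto (fun x : ℝ => x ^ (-2 / α) • p) atTop (𝓝 0) := by
    have : Tendsto (fun x : ℝ => x ^ (-2 / α)) atTop (𝓝 0) := by
      simpa [neg_div] using tendsto_rpow_neg_atTop (div_pos two_pos hα)
    simpa using this.smul_const p
  have hnorm : ∀ x : ℝ, 0 < x → x ^ 2 * ‖x ^ (-2 / α) • p‖ ^ α = ‖p‖ ^ α := fun x hx => by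
    rw [norm_smul, norm_of_nonneg (by positivity), mul_rpow (by positivity) (norm_nonneg _),
      ← rpow_mul hx.le, div_mul_cancel₀ _ hα.ne', ← mul_assoc, ← rpow_natCast, ← rpow_add hx]
    simp
  have ho : (fun x : ℝ => x ^ 2 * (r (x ^ (-2 / α) • p) - (1 - ‖x ^ (-2 / α) • p‖ ^ α)))
      =o[atTop] fun _ => (1 : ℝ) := by
    refine ((isBigO_refl (fun x : ℝ => x ^ 2) atTop).mul_isLittleO
      (hr.comp_tendsto hscale)).trans_isBigO (IsBigO.of_bound (‖p‖ ^ α) ?_)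
    filter_upwards [eventually_gt_atTop 0] with x hx
    simp only [Function.comp_apply]
    rw [hnorm x hx, norm_of_nonneg (by positivity)]
    simp
  have h := ((isLittleO_one_iff ℝ).1 ho).const_sub (‖p‖ ^ α)
  rw [sub_zero] at h
  refine h.congr' ?_
  filter_upwards [eventually_gt_atTop 0] with x hx
  rw [← hnorm x hx]
  ring

lemma IsHomogGaussianField.tendsto_measureReal_exists_lt_div_PsiFn {n : ℕ} {α : ℝ} (hα : 0 < α)
    {Ω : Type*} [MeasurableSpace Ω] {P : Measure Ω} [IsProbabilityMeasure P]
    {X : EuclideanSpace ℝ (Fin n) → Ω → ℝ} {r : EuclideanSpace ℝ (Fin n) → ℝ}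
    (hX : IsHomogGaussianField P X r)
    (hr : (fun t => r t - (1 - ‖t‖ ^ α)) =o[𝓝 0] fun t => ‖t‖ ^ α)
    {Ω' : Type*} [MeasurableSpace Ω'] {P' : Measure Ω'} [IsProbabilityMeasure P']
    {χ : EuclideanSpace ℝ (Fin n) → Ω' → ℝ} (hχ : IsChiAlpha P' α χ)
    {ι : Type*} [Fintype ι] [Nonempty ι] {p q : ι → EuclideanSpace ℝ (Fin n)}
    (hpq : ∀ i, ‖p i‖ = ‖q i‖) (hpq' : ∀ i j, ‖p i - p j‖ = ‖q i - q j‖) :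
    Tendsto (fun x : ℝ => P.real {ω | ∃ i, x < X (x ^ (-2 / α) • p i) ω} / PsiFn x) atTop
      (𝓝 (∫ ω, exp (⨆ i, χ (q i) ω) ∂P')) := by
  refine tendsto_of_seq_tendsto fun x hx => ?_
  let t : ℕ → ι → EuclideanSpace ℝ (Fin n) := fun m i => x m ^ (-2 / α) • p i
  let Y : ℕ → ι → Ω → ℝ := fun m i ω => X (t m i) ω - r (t m i) * X 0 ω
  let Z : ℕ → ι → Ω → ℝ := fun m i ω => x m * Y m i ω - x m ^ 2 * (1 - r (t m i))
  have hA : ∀ v, Tendsto (fun m => x m ^ 2 * (1 - r (x m ^ (-2 / α) • v))) atTop (𝓝 (‖v‖ ^ α)) :=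
    fun v => (tendsto_sq_mul_one_sub hα hr v).comp hx
  have hpos : ∀ᶠ m in atTop, 0 < x m := hx.eventually_gt_atTop 0
  have hρ : ∀ i, Tendsto (fun m => r (t m i)) atTop (𝓝 1) := fun i => by
    have hinv : Tendsto (fun m => (x m ^ 2)⁻¹) atTop (𝓝 0) :=
      ((tendsto_pow_atTop two_ne_zero).comp hx).inv_tendsto_atTop
    have h := ((hA (p i)).mul hinv).const_sub 1
    rw [mul_zero, sub_zero] at h
    refine h.congr' (hpos.mono fun m hm => ?_)
    simp only [t]
    field_simp
    ring
  have hYm : ∀ m i, Measurable (Y m i) := fun m i =>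
    (hX.meas _).sub ((hX.meas 0).const_mul _)
  have hYg : ∀ m, HasGaussianLaw (fun ω i => Y m i ω) P := fun m =>
    (hX.hasGaussianLaw_residual (t m) fun i => r (t m i)).snd
  have hYi : ∀ m i, Integrable (Y m i) P := fun m i => ((hYg m).eval i).integrable
  have hZg : ∀ m, HasGaussianLaw (fun ω i => Z m i ω) P := fun m => by
    simpa [sub_eq_add_neg, Z] using! ((hYg m).fun_smul (x m)).fun_add_const
      fun i => -(x m ^ 2 * (1 - r (t m i)))
  have hχg : HasGaussianLaw (fun ω i => χ (q i) ω) P' := hχ.gaussian.hasGaussianLaw hχ.meas q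
  have hYmean : ∀ m i, ∫ ω, Y m i ω ∂P = 0 := fun m i => by
    rw [integral_sub ((hX.memLp _).integrable (by norm_num))
      (((hX.memLp 0).integrable (by norm_num)).const_mul _), integral_const_mul, hX.mean, hX.mean]
    simp
  have hmean : ∀ i, Tendsto (fun m => ∫ ω, Z m i ω ∂P) atTop (𝓝 (∫ ω, χ (q i) ω ∂P')) := fun i => by
    rw [hχ.mean, ← hpq]
    refine (hA (p i)).neg.congr fun m => ?_
    rw [integral_sub ((hYi m i).const_mul _) (integrable_const _), integral_const_mul, hYmean]
    simp [t]
  have hcov : ∀ i j, Tendsto (fun m => cov[Z m i, Z m j; P]) atTop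
      (𝓝 cov[χ (q i), χ (q j); P']) := fun i j => by
    rw [covariance_eq_sub (hχg.eval i).memLp_two (hχg.eval j).memLp_two]
    simp only [Pi.mul_apply]
    rw [hχ.cov, ← hpq, ← hpq, ← hpq']
    have h := (((hA (p i)).add (hA (p j))).sub (hA (p i - p j))).sub
      ((hA (p i)).mul ((hρ j).const_sub 1))
    rw [sub_self, mul_zero, sub_zero] at h
    refine h.congr fun m => ?_
    rw [covariance_sub_const_left ((hYi m i).const_mul _),
      covariance_sub_const_right ((hYi m j).const_mul _), covariance_const_mul_left,
      covariance_const_mul_right, hX.covariance_residual]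
    simp only [t, smul_sub]
    ring
  refine (tendsto_integral_exp_mul_measureReal_exists_lt (fun m i => ?_) (fun i => hχ.meas _) hZg
    hχg hmean hcov hρ hx).congr' (hpos.mono fun m hm => ?_)
  · exact ((hYm m i).const_mul _).sub_const _
  · rw [← measureReal_exists_lt_div_PsiFn (hX.meas 0) (hYm m) hX.map_zero
      (hX.indepFun_residual (t m)) _ hm]
    simp [Y, t]

lemma Orthonormal.norm_sum_smul {ι E : Type*} [Fintype ι] [NormedAddCommGroup E]
    [InnerProductSpace ℝ E] {M : ι → E} (hM : Orthonormal ℝ M) (a : EuclideanSpace ℝ ι) :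
    ‖∑ k, a k • M k‖ = ‖a‖ := by
  rw [← sq_eq_sq₀ (norm_nonneg _) (norm_nonneg _), ← real_inner_self_eq_norm_sq, hM.inner_sum,
    EuclideanSpace.norm_sq_eq]
  simp [sq]

/-- Let `X` be a centered homogeneous Gaussian field on `ℝ^n` with
covariance `r(t) = 1 − ‖t‖^α + o(‖t‖^α)` (`0 < α ≤ 2`, `1 ≤ r ≤ n`), let `M_1,…,M_n` be
an orthonormal basis of `ℝ^n`, `l ≥ 1`, `γ > 0`, and for `x > 0` let
`G_x = {∑_k i_k γ x^{−2/α} M_k : i_k ∈ {0,…,l} for k ≤ r, i_k = 0 for k > r}`. Then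
`P(max_{t∈G_x} X(t) > x)/Ψ(x) → H_α(C^r(l,γ))` and
`P(min_{t∈G_x} X(t) < −x)/Ψ(x) → H_α(C^r(l,γ))` as `x → ∞`. -/
theorem stmt5 (n rr : ℕ) (hn : 1 ≤ n) (hrr1 : 1 ≤ rr) (hrrn : rr ≤ n)
    (α : ℝ) (hα0 : 0 < α) (hα2 : α ≤ 2)
    {Ω : Type*} [MeasurableSpace Ω] (P : Measure Ω) [IsProbabilityMeasure P]
    (X : EuclideanSpace ℝ (Fin n) → Ω → ℝ) (r : EuclideanSpace ℝ (Fin n) → ℝ)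
    (hX : IsHomogGaussianField P X r)
    (hrα : (fun t => r t - (1 - ‖t‖ ^ α))
      =o[𝓝 0] fun t : EuclideanSpace ℝ (Fin n) => ‖t‖ ^ α)
    {Ω' : Type*} [MeasurableSpace Ω'] (P' : Measure Ω') [IsProbabilityMeasure P']
    (χ : EuclideanSpace ℝ (Fin n) → Ω' → ℝ) (hχ : IsChiAlpha P' α χ)
    (M : Fin n → EuclideanSpace ℝ (Fin n)) (hM : Orthonormal ℝ M)
    (l : ℕ) (hl : 1 ≤ l) (γ : ℝ) (hγ : 0 < γ) :
    Tendsto (fun x : ℝ =>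
        (P {ω | ∃ i : Fin n → ℕ, (∀ k : Fin n, (k : ℕ) < rr → i k ≤ l) ∧
            (∀ k : Fin n, rr ≤ (k : ℕ) → i k = 0) ∧
            x < X (∑ k, ((i k : ℝ) * γ * x ^ (-2 / α)) • M k) ω}).toReal / PsiFn x)
      atTop (𝓝 (HalphaSet P' χ (CrSet n rr l γ)))
    ∧ Tendsto (fun x : ℝ =>
        (P {ω | ∃ i : Fin n → ℕ, (∀ k : Fin n, (k : ℕ) < rr → i k ≤ l) ∧
            (∀ k : Fin n, rr ≤ (k : ℕ) → i k = 0) ∧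
            X (∑ k, ((i k : ℝ) * γ * x ^ (-2 / α)) • M k) ω < -x}).toReal / PsiFn x)
      atTop (𝓝 (HalphaSet P' χ (CrSet n rr l γ))) := by
  have hkey : ∀ Y : EuclideanSpace ℝ (Fin n) → Ω → ℝ, IsHomogGaussianField P Y r →
      Tendsto (fun x : ℝ =>
        (P {ω | ∃ i : Fin n → ℕ, (∀ k : Fin n, (k : ℕ) < rr → i k ≤ l) ∧
            (∀ k : Fin n, rr ≤ (k : ℕ) → i k = 0) ∧
            x < Y (∑ k, ((i k : ℝ) * γ * x ^ (-2 / α)) • M k) ω}).toReal / PsiFn x)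
      atTop (𝓝 (HalphaSet P' χ (CrSet n rr l γ))) := by
    intro Y hY
    let I : Set (Fin n → ℕ) := {i | (∀ k : Fin n, (k : ℕ) < rr → i k ≤ l) ∧
      ∀ k : Fin n, rr ≤ (k : ℕ) → i k = 0}
    have hI : I.Finite := (Set.finite_Iic fun _ => l).subset fun i hi k =>
      (lt_or_ge (k : ℕ) rr).elim (hi.1 k) fun h => (hi.2 k h).trans_le (Nat.zero_le l)
    have : Fintype I := hI.fintype
    have : Nonempty I := ⟨⟨0, fun _ _ => Nat.zero_le l, fun _ _ => rfl⟩⟩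
    let q : I → EuclideanSpace ℝ (Fin n) := fun i => WithLp.toLp 2 fun k => γ * (i.1 k : ℝ)
    let p : I → EuclideanSpace ℝ (Fin n) := fun i => ∑ k, q i k • M k
    have hrange : Set.range q = CrSet n rr l γ := by
      ext t
      constructor
      · rintro ⟨i, rfl⟩ k
        split_ifs with hk
        · exact ⟨i.1 k, i.2.1 k hk, rfl⟩
        · simp [q, i.2.2 k (not_lt.1 hk)]
      · intro ht
        have hex : ∀ k : Fin n, ∃ m : ℕ, t k = γ * m ∧ ((k : ℕ) < rr → m ≤ l) ∧
            (rr ≤ (k : ℕ) → m = 0) := fun k => by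
          have := ht k
          split_ifs at this with hk
          · obtain ⟨m, hm, h⟩ := this
            exact ⟨m, h, fun _ => hm, fun h' => absurd hk (not_lt.2 h')⟩
          · exact ⟨0, by simpa using this, fun h => absurd h hk, fun _ => rfl⟩
        choose m hm hm1 hm2 using hex
        refine ⟨⟨m, hm1, hm2⟩, ?_⟩
        ext k
        exact (hm k).symm
    have h := hY.tendsto_measureReal_exists_lt_div_PsiFn hα0 hrα hχ (p := p) (q := q)
      (fun i => hM.norm_sum_smul _) fun i j => by
        rw [← hM.norm_sum_smul (q i - q j), ← Finset.sum_sub_distrib]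
        simp [sub_smul]
    have hH : HalphaSet P' χ (CrSet n rr l γ) = ∫ ω, exp (⨆ i, χ (q i) ω) ∂P' := by
      rw [HalphaSet, ← hrange]
      simp_rw [← Set.range_comp]
      rfl
    rw [hH]
    refine h.congr fun x => ?_
    rw [measureReal_def]
    congr 3
    ext ω
    have hp : ∀ i : I, x ^ (-2 / α) • p i = ∑ k, ((i.1 k : ℝ) * γ * x ^ (-2 / α)) • M k := by
      intro i
      simp only [p, q, Finset.smul_sum, smul_smul]
      exact Finset.sum_congr rfl fun k _ => by ring_nf
    simp only [Set.mem_ofPred_eq, Subtype.exists, hp, I, exists_prop, and_assoc]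
  refine ⟨hkey X hX, ?_⟩
  simpa only [lt_neg] using hkey _ hX.neg
end

section
/- Fix n ≥ 1, 1 ≤ r ≤ n, and 0 < α ≤ 2, and let χ_α and H_α be as defined. Suppose that for every γ > 0 the limit H_α^{(r)}(γ) := lim_{l→∞} H_α(C^r(l,γ))/l^r exists and is finite, and that the limit H_α^{(r)} := lim_{q→∞} H_α([0,q]^r)/q^r exists and is finite. Then lim_{γ→0+} H_α^{(r)}(γ)/γ^r = H_α^{(r)}. -/
open MeasureTheory ProbabilityTheory Real Filter Asymptotics
open scoped Topology NNReal

/-- The cube `[0,q]^r = {t ∈ ℝ^n : t_i ∈ [0,q] for 1 ≤ i ≤ r, t_i = 0 for r < i ≤ n}`. -/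
def CubeSet (n rr : ℕ) (q : ℝ) : Set (EuclideanSpace ℝ (Fin n)) :=
  {t | ∀ k : Fin n, if (k : ℕ) < rr then t k ∈ Set.Icc 0 q else t k = 0}

namespace IsChiAlpha

variable {Ω : Type*} [MeasurableSpace Ω] {P : Measure Ω} {n : ℕ} {α : ℝ}
  {χ : EuclideanSpace ℝ (Fin n) → Ω → ℝ} {ι : Type*} [Fintype ι]

lemma exists_map_sum_eq_gaussianReal (hχ : IsChiAlpha P α χ) (a : ι → ℝ)
    (u : ι → EuclideanSpace ℝ (Fin n)) :
    ∃ (m : ℝ) (v : ℝ≥0), P.map (fun ω => ∑ i, a i * χ (u i) ω) = gaussianReal m v := by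
  obtain ⟨m, v, h⟩ := hχ.gaussian (Fintype.card ι) (a ∘ (Fintype.equivFin ι).symm)
    (u ∘ (Fintype.equivFin ι).symm)
  refine ⟨m, v, ?_⟩
  rw [← h]
  congr 1
  funext ω
  exact ((Fintype.equivFin ι).symm.sum_comp (fun i => a i * χ (u i) ω)).symm

lemma memLp_two (hχ : IsChiAlpha P α χ) (t : EuclideanSpace ℝ (Fin n)) : MemLp (χ t) 2 P := by
  obtain ⟨m, v, h⟩ := hχ.exists_map_sum_eq_gaussianReal (fun _ : Unit => 1) (fun _ => t)
  simp only [Finset.univ_unique, one_mul, Finset.sum_const, Finset.card_singleton,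
    one_smul] at h
  have h2 : MemLp id 2 (P.map (χ t)) := by
    have := memLp_id_gaussianReal (μ := m) (v := v) 2
    rw [← h] at this
    exact_mod_cast this
  exact (memLp_map_measure_iff (by fun_prop) (hχ.meas t).aemeasurable).1 h2

lemma covariance_eq [IsProbabilityMeasure P] (hχ : IsChiAlpha P α χ)
    (t s : EuclideanSpace ℝ (Fin n)) :
    cov[χ t, χ s; P] = ‖t‖ ^ α + ‖s‖ ^ α - ‖t - s‖ ^ α := by
  rw [covariance_eq_sub (hχ.memLp_two t) (hχ.memLp_two s), ← hχ.cov t s]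
  rfl

lemma integral_sum (hχ : IsChiAlpha P α χ) [IsProbabilityMeasure P] (a : ι → ℝ)
    (u : ι → EuclideanSpace ℝ (Fin n)) :
    ∫ ω, ∑ i, a i * χ (u i) ω ∂P = - ∑ i, a i * ‖u i‖ ^ α := by
  rw [integral_finsetSum _ fun i _ => ((hχ.memLp_two (u i)).integrable one_le_two).const_mul _]
  simp_rw [integral_const_mul, hχ.mean, mul_neg, Finset.sum_neg_distrib]

lemma variance_sum (hχ : IsChiAlpha P α χ) [IsProbabilityMeasure P] (a : ι → ℝ)
    (u : ι → EuclideanSpace ℝ (Fin n)) :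
    Var[fun ω => ∑ i, a i * χ (u i) ω; P]
      = ∑ i, ∑ j, a i * a j * (‖u i‖ ^ α + ‖u j‖ ^ α - ‖u i - u j‖ ^ α) := by
  rw [variance_fun_sum fun i => (hχ.memLp_two (u i)).const_mul _]
  simp_rw [covariance_const_mul_left, covariance_const_mul_right, hχ.covariance_eq, mul_assoc]

lemma integrable_exp_sum (hχ : IsChiAlpha P α χ) (a : ι → ℝ)
    (u : ι → EuclideanSpace ℝ (Fin n)) :
    Integrable (fun ω => rexp (∑ i, a i * χ (u i) ω)) P := by
  obtain ⟨m, v, h⟩ := hχ.exists_map_sum_eq_gaussianReal a u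
  have hm : Measurable fun ω => ∑ i, a i * χ (u i) ω :=
    Finset.measurable_sum _ fun i _ => (hχ.meas (u i)).const_mul _
  have := integrable_exp_mul_gaussianReal (μ := m) (v := v) 1
  rw [← h, integrable_map_measure (by fun_prop) hm.aemeasurable] at this
  simpa [Function.comp_def] using this

/-- Exponential moments of linear combinations with total mass one see only the increments. -/
lemma integral_exp_sum (hχ : IsChiAlpha P α χ) [IsProbabilityMeasure P] (a : ι → ℝ)
    (u : ι → EuclideanSpace ℝ (Fin n)) (ha : ∑ i, a i = 1) :
    ∫ ω, rexp (∑ i, a i * χ (u i) ω) ∂P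
      = rexp (-(∑ i, ∑ j, a i * a j * ‖u i - u j‖ ^ α) / 2) := by
  obtain ⟨m, v, h⟩ := hχ.exists_map_sum_eq_gaussianReal a u
  have hm : Measurable fun ω => ∑ i, a i * χ (u i) ω :=
    Finset.measurable_sum _ fun i _ => (hχ.meas (u i)).const_mul _
  have h1 : m = - ∑ i, a i * ‖u i‖ ^ α := by
    rw [← hχ.integral_sum, ← integral_map (f := fun x => x) hm.aemeasurable (by fun_prop), h,
      integral_id_gaussianReal]
  have h2 : (v : ℝ) = ∑ i, ∑ j, a i * a j * (‖u i‖ ^ α + ‖u j‖ ^ α - ‖u i - u j‖ ^ α) := by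
    rw [← hχ.variance_sum, ← variance_id_map hm.aemeasurable, h, variance_id_gaussianReal]
  have h3 := mgf_gaussianReal h 1
  simp only [mgf, one_mul, mul_one, one_pow] at h3
  rw [h3, h1, h2]
  congr 1
  simp_rw [mul_sub, mul_add, Finset.sum_sub_distrib, Finset.sum_add_distrib]
  have e1 : ∑ i, ∑ j, a i * a j * ‖u i‖ ^ α = ∑ i, a i * ‖u i‖ ^ α := by
    refine Finset.sum_congr rfl fun i _ => ?_
    rw [← Finset.sum_mul, ← Finset.mul_sum, ha, mul_one]
  have e2 : ∑ i, ∑ j, a i * a j * ‖u j‖ ^ α = ∑ i, a i * ‖u i‖ ^ α := by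
    rw [Finset.sum_comm]
    refine Finset.sum_congr rfl fun i _ => ?_
    rw [← Finset.sum_mul, ← Finset.sum_mul, ha, one_mul]
  rw [e1, e2]
  ring

lemma integrable_exp (hχ : IsChiAlpha P α χ) (t : EuclideanSpace ℝ (Fin n)) :
    Integrable (fun ω => rexp (χ t ω)) P := by
  simpa using hχ.integrable_exp_sum (fun _ : Unit => 1) (fun _ => t)

lemma integral_exp [IsProbabilityMeasure P] (hχ : IsChiAlpha P α χ) (hα : 0 < α)
    (t : EuclideanSpace ℝ (Fin n)) : ∫ ω, rexp (χ t ω) ∂P = 1 := by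
  simpa [hα.ne'] using hχ.integral_exp_sum (fun _ : Unit => 1) (fun _ => t) (by simp)

lemma mgf_tilted [IsProbabilityMeasure P] (hχ : IsChiAlpha P α χ) (hα : 0 < α)
    (a : ι → ℝ) (u : ι → EuclideanSpace ℝ (Fin n)) (s : EuclideanSpace ℝ (Fin n)) (z : ℝ) :
    mgf (fun ω => ∑ i, a i * (χ (s + u i) ω - χ s ω)) (P.tilted (χ s)) z
      = rexp (-(∑ i : Option ι, ∑ j : Option ι,
          i.elim (1 - z * ∑ k, a k) (fun k => z * a k) *
          j.elim (1 - z * ∑ k, a k) (fun k => z * a k) *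
          ‖i.elim 0 u - j.elim 0 u‖ ^ α) / 2) := by
  rw [mgf, integral_tilted, hχ.integral_exp hα]
  have := hχ.integral_exp_sum (ι := Option ι)
    (fun i => i.elim (1 - z * ∑ k, a k) (fun k => z * a k)) (fun i => s + i.elim 0 u)
    (by simp [Fintype.sum_option, Finset.mul_sum])
  simp only [add_sub_add_left_eq_sub] at this
  rw [← this]
  refine integral_congr_ae (ae_of_all _ fun ω => ?_)
  simp only [div_one, smul_eq_mul, ← Real.exp_add, Fintype.sum_option, Option.elim, add_zero]
  congr 1
  simp only [mul_sub, Finset.sum_sub_distrib, ← Finset.sum_mul, Finset.mul_sum, mul_assoc]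
  simp only [← Finset.mul_sum]
  ring

lemma map_sum_tilted_eq [IsProbabilityMeasure P] (hχ : IsChiAlpha P α χ) (hα : 0 < α)
    (a : ι → ℝ) (u : ι → EuclideanSpace ℝ (Fin n)) (s s' : EuclideanSpace ℝ (Fin n)) :
    (P.tilted (χ s)).map (fun ω => ∑ i, a i * (χ (s + u i) ω - χ s ω))
      = (P.tilted (χ s')).map (fun ω => ∑ i, a i * (χ (s' + u i) ω - χ s' ω)) := by
  have hm (s) : Measurable fun ω => ∑ i, a i * (χ (s + u i) ω - χ s ω) :=
    Finset.measurable_sum _ fun i _ => ((hχ.meas _).sub (hχ.meas _)).const_mul _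
  have := isProbabilityMeasure_tilted (hχ.integrable_exp s)
  have := isProbabilityMeasure_tilted (hχ.integrable_exp s')
  refine Measure.ext_of_complexMGF_eq (hm s).aemeasurable (hm s').aemeasurable ?_
  have key := eqOn_complexMGF_of_mgf (X := fun ω => ∑ i, a i * (χ (s + u i) ω - χ s ω))
    (Y := fun ω => ∑ i, a i * (χ (s' + u i) ω - χ s' ω)) (μ := P.tilted (χ s))
    (μ' := P.tilted (χ s')) (by ext z; rw [hχ.mgf_tilted hα, hχ.mgf_tilted hα])
  have huniv : integrableExpSet (fun ω => ∑ i, a i * (χ (s + u i) ω - χ s ω))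
      (P.tilted (χ s)) = Set.univ := by
    refine Set.eq_univ_of_forall fun z => ?_
    simp only [integrableExpSet, Set.mem_ofPred_eq]
    rw [← mgf_pos_iff, hχ.mgf_tilted hα]
    exact Real.exp_pos _
  ext z
  exact key (by simp [huniv])

lemma map_increments_tilted_eq [IsProbabilityMeasure P] (hχ : IsChiAlpha P α χ) (hα : 0 < α)
    (u : ι → EuclideanSpace ℝ (Fin n)) (s s' : EuclideanSpace ℝ (Fin n)) :
    (P.tilted (χ s)).map (fun ω i => χ (s + u i) ω - χ s ω)
      = (P.tilted (χ s')).map (fun ω i => χ (s' + u i) ω - χ s' ω) := by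
  classical
  have hm (s) : Measurable fun ω i => χ (s + u i) ω - χ s ω :=
    measurable_pi_lambda _ fun i => (hχ.meas _).sub (hχ.meas _)
  have := isProbabilityMeasure_tilted (hχ.integrable_exp s)
  have := isProbabilityMeasure_tilted (hχ.integrable_exp s')
  have := Measure.isProbabilityMeasure_map (μ := P.tilted (χ s)) (hm s).aemeasurable
  have := Measure.isProbabilityMeasure_map (μ := P.tilted (χ s')) (hm s').aemeasurable
  refine Measure.ext_of_charFunDual ?_
  ext L
  have hL (x : ι → ℝ) : L x = ∑ i, L (Pi.single i 1) * x i := by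
    conv_lhs => rw [← Finset.univ_sum_single x, map_sum]
    refine Finset.sum_congr rfl fun i _ => ?_
    rw [mul_comm, ← smul_eq_mul, ← map_smul, ← Pi.single_smul, smul_eq_mul, mul_one]
  rw [charFunDual_eq_charFun_map_one, charFunDual_eq_charFun_map_one,
    Measure.map_map (by fun_prop) (hm s), Measure.map_map (by fun_prop) (hm s')]
  have e (s) : (⇑L ∘ fun ω i => χ (s + u i) ω - χ s ω)
      = fun ω => ∑ i, L (Pi.single i 1) * (χ (s + u i) ω - χ s ω) := funext fun ω => hL _
  rw [e, e]
  congr 1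
  exact hχ.map_sum_tilted_eq hα (fun i => L (Pi.single i 1)) u s s'

/-- Homogeneity of expected exponential maxima over finitely many points. -/
lemma integral_exp_iSup_add [IsProbabilityMeasure P] (hχ : IsChiAlpha P α χ) (hα : 0 < α)
    [Nonempty ι] (u : ι → EuclideanSpace ℝ (Fin n)) (s s' : EuclideanSpace ℝ (Fin n)) :
    ∫ ω, rexp (⨆ i, χ (s + u i) ω) ∂P = ∫ ω, rexp (⨆ i, χ (s' + u i) ω) ∂P := by
  have hm (s) : Measurable fun ω i => χ (s + u i) ω - χ s ω :=
    measurable_pi_lambda _ fun i => (hχ.meas _).sub (hχ.meas _)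
  have key (s) : ∫ ω, rexp (⨆ i, χ (s + u i) ω) ∂P
      = ∫ x, rexp (⨆ i, x i) ∂((P.tilted (χ s)).map (fun ω i => χ (s + u i) ω - χ s ω)) := by
    rw [integral_map (hm s).aemeasurable
      (Measurable.iSup fun i => measurable_pi_apply i).exp.aestronglyMeasurable,
      integral_tilted, hχ.integral_exp hα]
    refine integral_congr_ae (ae_of_all _ fun ω => ?_)
    simp only [div_one, smul_eq_mul, ← Real.exp_add]
    congr 1
    rw [add_ciSup (Set.finite_range _).bddAbove]
    simp
  rw [key s, key s', hχ.map_increments_tilted_eq hα u s s']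

end IsChiAlpha

section Grids

variable {n rr : ℕ}

lemma zero_mem_CrSet (l : ℕ) (γ : ℝ) : (0 : EuclideanSpace ℝ (Fin n)) ∈ CrSet n rr l γ := by
  intro k
  split_ifs
  · exact ⟨0, Nat.zero_le _, by simp⟩
  · rfl

lemma CrSet_nonempty (l : ℕ) (γ : ℝ) : (CrSet n rr l γ).Nonempty := ⟨0, zero_mem_CrSet l γ⟩

lemma finite_CrSet (l : ℕ) (γ : ℝ) : (CrSet n rr l γ).Finite := by
  refine (Set.finite_range fun c : Fin n → Fin (l + 1) =>
    (WithLp.toLp 2 fun k => γ * (c k : ℕ) : EuclideanSpace ℝ (Fin n))).subset fun t ht => ?_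
  have h (k : Fin n) : ∃ m : Fin (l + 1), t k = γ * (m : ℕ) := by
    have := ht k
    split_ifs at this with hk
    · obtain ⟨m, hm, h⟩ := this
      exact ⟨⟨m, Nat.lt_succ_of_le hm⟩, h⟩
    · exact ⟨0, by simpa using this⟩
  choose c hc using h
  refine ⟨c, ?_⟩
  ext k
  exact (hc k).symm

lemma isCompact_CubeSet (q : ℝ) : IsCompact (CubeSet n rr q) := by
  have h : IsCompact (Set.univ.pi fun k : Fin n => if (k : ℕ) < rr then Set.Icc 0 q else {0}) :=
    isCompact_univ_pi fun k => by
      split_ifs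
      exacts [isCompact_Icc, isCompact_singleton]
  convert! h.image (PiLp.continuous_toLp 2 fun _ : Fin n => ℝ) using 1
  ext t
  constructor
  · intro ht
    refine ⟨t.ofLp, fun k _ => ?_, rfl⟩
    have := ht k
    dsimp only
    split_ifs at this ⊢
    exacts [this, this]
  · rintro ⟨x, hx, rfl⟩ k
    have := hx k trivial
    dsimp only at this ⊢
    split_ifs at this ⊢
    exacts [this, this]

lemma CrSet_subset_CubeSet {l : ℕ} {γ q : ℝ} (hγ : 0 ≤ γ) (h : l * γ ≤ q) :
    CrSet n rr l γ ⊆ CubeSet n rr q := by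
  intro t ht k
  have := ht k
  split_ifs at this ⊢
  · obtain ⟨m, hm, h'⟩ := this
    have hm' : (m : ℝ) ≤ l := mod_cast hm
    rw [h']
    exact ⟨by positivity, by nlinarith⟩
  · exact this

lemma CubeSet_nonempty {q : ℝ} (hq : 0 ≤ q) : (CubeSet n rr q).Nonempty :=
  (CrSet_nonempty 0 0).mono (CrSet_subset_CubeSet le_rfl (by simpa using hq))

lemma CubeSet_subset_CubeSet {q q' : ℝ} (h : q ≤ q') : CubeSet n rr q ⊆ CubeSet n rr q' := by
  intro t ht k
  have := ht k
  split_ifs at this ⊢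
  exacts [⟨this.1, this.2.trans h⟩, this]

lemma CrSet_subset_refinement (m : ℕ) (γ : ℝ) {k : ℕ} (hk : 0 < k) :
    CrSet n rr m γ ⊆ CrSet n rr (m * k) (γ / k) := by
  intro t ht i
  have := ht i
  split_ifs at this ⊢
  · obtain ⟨p, hp, h⟩ := this
    refine ⟨p * k, Nat.mul_le_mul_right k hp, ?_⟩
    rw [h]
    push_cast
    field_simp
  · exact this

/-- The lower corner of the cell of side `q` with index `c`. -/
noncomputable def cellCorner (n : ℕ) {rr l : ℕ} (q : ℝ) (c : Fin rr → Fin l) :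
    EuclideanSpace ℝ (Fin n) :=
  WithLp.toLp 2 fun k => if h : (k : ℕ) < rr then q * (c ⟨k, h⟩ : ℕ) else 0

lemma cellCorner_add_image_CrSet_subset {l : ℕ} (m : ℕ) (γ : ℝ) (c : Fin rr → Fin l) :
    (cellCorner n (m * γ) c + ·) '' CrSet n rr m γ ⊆ CrSet n rr (l * m) γ := by
  rintro _ ⟨t, ht, rfl⟩ i
  have := ht i
  split_ifs at this ⊢ with hi
  · obtain ⟨p, hp, h⟩ := this
    refine ⟨c ⟨i, hi⟩ * m + p, ?_, ?_⟩
    · have := (c ⟨i, hi⟩).2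
      nlinarith
    · simp only [cellCorner, PiLp.add_apply, hi, dite_true, h]
      push_cast
      ring
  · simp [cellCorner, hi, this]

lemma exists_mem_cellCorner_add_image_CrSet {l m k : ℕ} (hl : 0 < l) (hk : 0 < k) {γ : ℝ}
    {t : EuclideanSpace ℝ (Fin n)} (hrr : rr ≤ n) (ht : t ∈ CrSet n rr (l * m * k) (γ / k)) :
    ∃ c : Fin rr → Fin l,
      t ∈ (cellCorner n (m * γ) c + ·) '' CrSet n rr (m * k) (γ / k) := by
  have h (i : Fin rr) : ∃ (c : Fin l) (p : ℕ), p ≤ m * k ∧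
      t ⟨i, i.2.trans_le hrr⟩ = m * γ * (c : ℕ) + γ / k * p := by
    have := ht ⟨i, i.2.trans_le hrr⟩
    simp only [i.2, if_true] at this
    obtain ⟨p, hp, h⟩ := this
    have key : ∃ c p', c < l ∧ p' ≤ m * k ∧ p = c * (m * k) + p' := by
      rcases lt_or_ge (p / (m * k)) l with hlt | hge
      · rcases Nat.eq_zero_or_pos (m * k) with h0 | hpos
        · refine ⟨0, 0, hl, by simp, ?_⟩
          rw [mul_assoc, h0] at hp
          omega
        · exact ⟨p / (m * k), p % (m * k), hlt, (Nat.mod_lt _ hpos).le,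
            by rw [mul_comm, Nat.div_add_mod]⟩
      · refine ⟨l - 1, m * k, by omega, le_rfl, ?_⟩
        have h1 : l * (m * k) ≤ p := (Nat.mul_le_mul_right _ hge).trans (Nat.div_mul_le_self _ _)
        obtain ⟨l', rfl⟩ : ∃ l', l = l' + 1 := ⟨l - 1, by omega⟩
        rw [Nat.add_sub_cancel, ← Nat.succ_mul]
        rw [mul_assoc] at hp
        exact le_antisymm hp h1
    obtain ⟨c, p', hc, hp', rfl⟩ := key
    refine ⟨⟨c, hc⟩, p', hp', ?_⟩
    rw [h]
    push_cast
    field_simp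
  choose c p hp h using h
  refine ⟨c, t - cellCorner n (m * γ) c, fun i => ?_, by simp⟩
  split_ifs with hi
  · refine ⟨p ⟨i, hi⟩, hp _, ?_⟩
    have := h ⟨i, hi⟩
    simp only [Fin.eta] at this
    simp [cellCorner, hi, this]
  · have := ht i
    simp only [hi, if_false] at this
    simp [cellCorner, hi, this]

lemma tendsto_sSup_image_CrSet {β : Type*} {F : Filter β} {N : β → ℕ} {γ : β → ℝ} {q : ℝ}
    (hq : 0 ≤ q) (hγ : Tendsto γ F (𝓝[>] 0)) (hN : Tendsto (fun b => N b * γ b) F (𝓝 q))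
    (hle : ∀ᶠ b in F, N b * γ b ≤ q) {f : EuclideanSpace ℝ (Fin n) → ℝ} (hf : Continuous f) :
    Tendsto (fun b => sSup (f '' CrSet n rr (N b) (γ b))) F (𝓝 (sSup (f '' CubeSet n rr q))) := by
  obtain ⟨t, ht, hmax, -⟩ := (isCompact_CubeSet (n := n) (rr := rr) q).exists_sSup_image_eq_and_ge
    (CubeSet_nonempty hq) hf.continuousOn
  have hbdd : BddAbove (f '' CubeSet n rr q) :=
    (isCompact_CubeSet q).bddAbove_image hf.continuousOn
  let x : β → EuclideanSpace ℝ (Fin n) := fun b => WithLp.toLp 2 fun k =>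
    if (k : ℕ) < rr then γ b * (min (N b) ⌊t k * (γ b)⁻¹⌋₊ : ℕ) else 0
  have hx : Tendsto x F (𝓝 t) := by
    refine ((PiLp.continuous_toLp 2 fun _ : Fin n => ℝ).tendsto t.ofLp).comp
      (tendsto_pi_nhds.2 fun k => ?_)
    have htk := ht k
    split_ifs at htk with hk
    · simp only [hk, if_true]
      have h1 : Tendsto (fun b => γ b * (⌊t k * (γ b)⁻¹⌋₊ : ℝ)) F (𝓝 (t k)) := by
        refine ((tendsto_nat_floor_mul_div_atTop htk.1).comp
          (tendsto_inv_nhdsGT_zero.comp hγ)).congr fun b => ?_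
        simp [mul_comm]
      have h2 := hN.min h1
      rw [min_eq_right htk.2] at h2
      refine h2.congr' ?_
      filter_upwards [hγ self_mem_nhdsWithin] with b hb
      rw [Nat.cast_min, mul_comm (N b : ℝ), mul_min_of_nonneg _ _ (le_of_lt hb)]
    · simp only [hk, if_false, htk]
      exact tendsto_const_nhds
  have hlow : Tendsto (fun b => f (x b)) F (𝓝 (sSup (f '' CubeSet n rr q))) :=
    hmax ▸ (hf.tendsto t).comp hx
  refine tendsto_of_tendsto_of_tendsto_of_le_of_le' hlow tendsto_const_nhds ?_ ?_
  · refine Eventually.of_forall fun b =>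
      le_csSup ((finite_CrSet _ _).image f).bddAbove ⟨x b, fun k => ?_, rfl⟩
    split_ifs with hk
    · exact ⟨min (N b) ⌊t k * (γ b)⁻¹⌋₊, min_le_left _ _, by simp [x, hk]⟩
    · simp [x, hk]
  · filter_upwards [hγ self_mem_nhdsWithin, hle] with b hb hb'
    exact csSup_le_csSup hbdd ((CrSet_nonempty _ _).image f)
      (Set.image_mono (CrSet_subset_CubeSet (le_of_lt hb) hb'))

lemma tendsto_const_div_succ {q : ℝ} (hq : 0 < q) :
    Tendsto (fun j : ℕ => q / (j + 1 : ℕ)) atTop (𝓝[>] 0) :=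
  tendsto_nhdsWithin_iff.2 ⟨(tendsto_const_div_atTop_nhds_zero_nat q).comp (tendsto_add_atTop_nat 1),
    Eventually.of_forall fun j => by simp only [Set.mem_Ioi]; positivity⟩

end Grids

namespace IsChiAlpha

variable {Ω : Type*} [MeasurableSpace Ω] {P : Measure Ω} {n : ℕ} {α : ℝ}
  {χ : EuclideanSpace ℝ (Fin n) → Ω → ℝ} {ι : Type*} [Fintype ι]

lemma isGaussian_map_centered (hχ : IsChiAlpha P α χ) [IsProbabilityMeasure P]
    (u : ι → EuclideanSpace ℝ (Fin n)) :
    IsGaussian (P.map fun ω i => χ (u i) ω + ‖u i‖ ^ α) ∧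
      ∀ L : StrongDual ℝ (ι → ℝ), ∫ x, L x ∂(P.map fun ω i => χ (u i) ω + ‖u i‖ ^ α) = 0 := by
  classical
  have hm : Measurable fun ω i => χ (u i) ω + ‖u i‖ ^ α :=
    measurable_pi_lambda _ fun i => (hχ.meas _).add_const _
  have hL (L : StrongDual ℝ (ι → ℝ)) (x : ι → ℝ) : L x = ∑ i, L (Pi.single i 1) * x i := by
    conv_lhs => rw [← Finset.univ_sum_single x, map_sum]
    refine Finset.sum_congr rfl fun i _ => ?_
    rw [mul_comm, ← smul_eq_mul, ← map_smul, ← Pi.single_smul, smul_eq_mul, mul_one]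
  have hL' (L : StrongDual ℝ (ι → ℝ)) (ω : Ω) : L (fun i => χ (u i) ω + ‖u i‖ ^ α)
      = ∑ i, L (Pi.single i 1) * χ (u i) ω + ∑ i, L (Pi.single i 1) * ‖u i‖ ^ α := by
    rw [hL]
    simp_rw [mul_add, Finset.sum_add_distrib]
  constructor
  · refine isGaussian_of_map_eq_gaussianReal fun L => ?_
    obtain ⟨m, v, h⟩ := hχ.exists_map_sum_eq_gaussianReal (fun i => L (Pi.single i 1)) u
    refine ⟨m + ∑ i, L (Pi.single i 1) * ‖u i‖ ^ α, v, ?_⟩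
    rw [← gaussianReal_map_add_const, ← h, Measure.map_map (by fun_prop) hm,
      Measure.map_map (by fun_prop)
        (Finset.measurable_sum _ fun i _ => (hχ.meas (u i)).const_mul _)]
    congr 1
    funext ω
    exact hL' L ω
  · intro L
    rw [integral_map hm.aemeasurable (by fun_prop)]
    simp_rw [hL']
    rw [integral_add (integrable_finsetSum _ fun i _ =>
        ((hχ.memLp_two (u i)).integrable one_le_two).const_mul _) (integrable_const _),
      hχ.integral_sum]
    simp

/-- Exponential moments of the maximum over finite subsets of a compact set are uniformly bounded,
by Fernique's theorem. -/
lemma exists_lintegral_exp_sSup_le (hχ : IsChiAlpha P α χ) (hα : 0 < α) [IsProbabilityMeasure P]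
    {K : Set (EuclideanSpace ℝ (Fin n))} (hK : IsCompact K) :
    ∃ C : ENNReal, C < ⊤ ∧ ∀ T ⊆ K, T.Finite → T.Nonempty →
      ∫⁻ ω, ENNReal.ofReal (rexp (sSup ((fun t => χ t ω) '' T))) ∂P ≤ C := by
  let S : ℕ → Set Ω := fun N => {ω | ∀ t ∈ K, |χ t ω + ‖t‖ ^ α| ≤ N}
  have hS_mono : Monotone S := fun N N' h ω hω t ht => (hω t ht).trans (by exact_mod_cast h)
  have hS_univ : ⋃ N, S N = Set.univ := by
    refine Set.eq_univ_of_forall fun ω => ?_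
    have hc : Continuous fun t => χ t ω + ‖t‖ ^ α :=
      (hχ.cont ω).add (continuous_norm.rpow_const fun _ => Or.inr hα.le)
    obtain ⟨B, hB⟩ := hK.exists_bound_of_continuousOn hc.continuousOn
    obtain ⟨N, hN⟩ := exists_nat_ge B
    exact Set.mem_iUnion.2 ⟨N, fun t ht => (hB t ht).trans hN⟩
  let c : ENNReal := 3 / 4
  have hc : c = ENNReal.ofReal (3 / 4) := by
    rw [ENNReal.ofReal_div_of_pos (by norm_num)]
    simp [c]
  have hc_lt : c < 1 := by
    rw [hc, ← ENNReal.ofReal_one]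
    exact (ENNReal.ofReal_lt_ofReal_iff one_pos).2 (by norm_num)
  have hc_gt : 2⁻¹ < c := by
    have : (2⁻¹ : ENNReal) = ENNReal.ofReal 2⁻¹ := by
      rw [ENNReal.ofReal_inv_of_pos two_pos]; simp
    rw [hc, this]
    exact (ENNReal.ofReal_lt_ofReal_iff (by norm_num)).2 (by norm_num)
  obtain ⟨N, hN0, hNc⟩ : ∃ N : ℕ, 0 < N ∧ c < P (S N) := by
    have h := tendsto_measure_iUnion_atTop (μ := P) hS_mono
    rw [hS_univ, measure_univ] at h
    exact ((eventually_gt_atTop 0).and (h.eventually (lt_mem_nhds hc_lt))).exists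
  have hN0' : (0 : ℝ) < N := mod_cast hN0
  set κ : ℝ := Fernique.logRatio c * (N : ℝ)⁻¹ ^ 2 with hκ
  have hκ0 : 0 < κ := mul_pos (Fernique.logRatio_pos hc_gt hc_lt) (by positivity)
  let B : ENNReal := .ofReal (rexp (Fernique.logRatio c))
        + ∑' n, .ofReal (rexp (-2⁻¹ * Real.log (c / (1 - c)).toReal * 2 ^ n))
  have hB : B < ⊤ := by
    refine ENNReal.add_lt_top.mpr ⟨ENNReal.ofReal_lt_top, ?_⟩
    refine Summable.tsum_ofReal_lt_top <|
      Real.summable_exp_nat_mul_of_ge ?_ (fun i ↦ mod_cast (Nat.lt_pow_self (by simp)).le)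
    refine mul_neg_of_neg_of_pos (by simp) (Real.log_pos ?_)
    have : (1 - c : ENNReal) = ENNReal.ofReal (1 / 4) := by
      rw [hc, ← ENNReal.ofReal_one, ← ENNReal.ofReal_sub _ (by norm_num)]
      norm_num
    rw [ENNReal.toReal_div, this, hc, ENNReal.toReal_ofReal (by norm_num),
      ENNReal.toReal_ofReal (by norm_num)]
    norm_num
  refine ⟨ENNReal.ofReal (rexp (1 / (4 * κ))) * B, ENNReal.mul_lt_top ENNReal.ofReal_lt_top hB,
    fun T hTK hT hTne => ?_⟩
  have := hT.fintype
  have := hTne.to_subtype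
  have hm : Measurable fun ω (t : T) => χ t ω + ‖(t : EuclideanSpace ℝ (Fin n))‖ ^ α :=
    measurable_pi_lambda _ fun i => (hχ.meas _).add_const _
  obtain ⟨hG, hmean⟩ := hχ.isGaussian_map_centered (ι := T) (fun t => t)
  set μ := P.map fun ω (t : T) => χ t ω + ‖(t : EuclideanSpace ℝ (Fin n))‖ ^ α with hμ
  have hcμ : c ≤ μ {x | ‖x‖ ≤ N} := by
    rw [hμ, Measure.map_apply hm (measurableSet_le (by fun_prop) (by fun_prop))]
    refine hNc.le.trans (measure_mono fun ω hω => ?_)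
    exact (pi_norm_le_iff_of_nonneg hN0'.le).2 fun t => hω t (hTK t.2)
  have hF := lintegral_exp_mul_sq_norm_le_of_map_rotation_eq_self
    (IsGaussian.map_rotation_eq_self_of_forall_strongDual_eq_zero hmean _) hcμ hc_gt
  rw [hμ, lintegral_map (by fun_prop) hm] at hF
  calc ∫⁻ ω, ENNReal.ofReal (rexp (sSup ((fun t => χ t ω) '' T))) ∂P
      ≤ ∫⁻ ω, ENNReal.ofReal (rexp (1 / (4 * κ))) * ENNReal.ofReal (rexp (κ *
          ‖fun t : T => χ t ω + ‖(t : EuclideanSpace ℝ (Fin n))‖ ^ α‖ ^ 2)) ∂P := by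
        refine lintegral_mono fun ω => ?_
        rw [← ENNReal.ofReal_mul (by positivity), ← Real.exp_add]
        refine ENNReal.ofReal_le_ofReal (Real.exp_le_exp.2 ?_)
        set y := ‖fun t : T => χ t ω + ‖(t : EuclideanSpace ℝ (Fin n))‖ ^ α‖ with hy
        have h1 : sSup ((fun t => χ t ω) '' T) ≤ y := by
          refine csSup_le (hTne.image _) ?_
          rintro _ ⟨t, ht, rfl⟩
          have h2 : |χ t ω + ‖t‖ ^ α| ≤ y := norm_le_pi_norm
            (fun t : T => χ t ω + ‖(t : EuclideanSpace ℝ (Fin n))‖ ^ α) ⟨t, ht⟩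
          have h3 : 0 ≤ ‖t‖ ^ α := by positivity
          have h4 := le_abs_self (χ t ω + ‖t‖ ^ α)
          dsimp only
          linarith
        have h5 : 1 / (4 * κ) + κ * y ^ 2 - y = (2 * κ * y - 1) ^ 2 / (4 * κ) := by
          field_simp
          ring
        have h6 : 0 ≤ (2 * κ * y - 1) ^ 2 / (4 * κ) := by positivity
        linarith
    _ ≤ _ := by
        rw [lintegral_const_mul' _ _ ENNReal.ofReal_ne_top]
        gcongr

lemma measurable_exp_sSup (hχ : IsChiAlpha P α χ) {T : Set (EuclideanSpace ℝ (Fin n))}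
    (hT : T.Finite) : Measurable fun ω => rexp (sSup ((fun t => χ t ω) '' T)) := by
  have := hT.countable.to_subtype
  simp_rw [sSup_image']
  exact (Measurable.iSup fun t : T => hχ.meas t).exp

lemma measurable_exp_sSup_CubeSet (hχ : IsChiAlpha P α χ) {rr : ℕ} {q : ℝ} (hq : 0 < q) :
    Measurable fun ω => rexp (sSup ((fun t => χ t ω) '' CubeSet n rr q)) := by
  refine measurable_of_tendsto_metrizable
    (fun j : ℕ => hχ.measurable_exp_sSup (finite_CrSet (rr := rr) (j + 1) (q / (j + 1 : ℕ))))
    (tendsto_pi_nhds.2 fun ω => ?_)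
  have h (j : ℕ) : ((j + 1 : ℕ) : ℝ) * (q / (j + 1 : ℕ)) = q := mul_div_cancel₀ _ (by positivity)
  exact (tendsto_sSup_image_CrSet hq.le (tendsto_const_div_succ hq) (by simp [-Nat.cast_add, h])
    (by simp [-Nat.cast_add, h]) (hχ.cont ω)).rexp

lemma integrable_exp_sSup_CubeSet (hχ : IsChiAlpha P α χ) (hα : 0 < α) [IsProbabilityMeasure P]
    {rr : ℕ} {q : ℝ} (hq : 0 < q) :
    Integrable (fun ω => rexp (sSup ((fun t => χ t ω) '' CubeSet n rr q))) P := by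
  refine ⟨(hχ.measurable_exp_sSup_CubeSet hq).aestronglyMeasurable, ?_⟩
  obtain ⟨C, hC, h⟩ := hχ.exists_lintegral_exp_sSup_le hα (isCompact_CubeSet (rr := rr) q)
  have hj (j : ℕ) : ((j + 1 : ℕ) : ℝ) * (q / (j + 1 : ℕ)) = q := mul_div_cancel₀ _ (by positivity)
  have hlim (ω : Ω) : Tendsto (fun j : ℕ => ENNReal.ofReal (rexp (sSup ((fun t => χ t ω) ''
      CrSet n rr (j + 1) (q / (j + 1 : ℕ)))))) atTop
      (𝓝 (ENNReal.ofReal (rexp (sSup ((fun t => χ t ω) '' CubeSet n rr q))))) :=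
    ENNReal.tendsto_ofReal (tendsto_sSup_image_CrSet hq.le (tendsto_const_div_succ hq)
      (by simp [-Nat.cast_add, hj]) (by simp [-Nat.cast_add, hj]) (hχ.cont ω)).rexp
  simp only [HasFiniteIntegral, ← ofReal_norm, Real.norm_eq_abs, Real.abs_exp]
  calc ∫⁻ ω, ENNReal.ofReal (rexp (sSup ((fun t => χ t ω) '' CubeSet n rr q))) ∂P
      = ∫⁻ ω, liminf (fun j : ℕ => ENNReal.ofReal (rexp (sSup ((fun t => χ t ω) ''
        CrSet n rr (j + 1) (q / (j + 1 : ℕ)))))) atTop ∂P :=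
        lintegral_congr fun ω => (hlim ω).liminf_eq.symm
    _ ≤ liminf (fun j : ℕ => ∫⁻ ω, ENNReal.ofReal (rexp (sSup ((fun t => χ t ω) ''
        CrSet n rr (j + 1) (q / (j + 1 : ℕ))))) ∂P) atTop :=
        lintegral_liminf_le fun j => (hχ.measurable_exp_sSup (finite_CrSet _ _)).ennreal_ofReal
    _ ≤ C := by
        refine liminf_le_of_le (by isBoundedDefault) fun b hb => ?_
        obtain ⟨j, hj'⟩ := hb.exists
        exact hj'.trans (h _ (CrSet_subset_CubeSet (by positivity) (hj j).le)
          (finite_CrSet _ _) (CrSet_nonempty _ _))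
    _ < ⊤ := hC

lemma exp_sSup_mono (hχ : IsChiAlpha P α χ) {T T' : Set (EuclideanSpace ℝ (Fin n))}
    (hT : T.Nonempty) (h : T ⊆ T') (hT' : ∃ K, IsCompact K ∧ T' ⊆ K) (ω : Ω) :
    rexp (sSup ((fun t => χ t ω) '' T)) ≤ rexp (sSup ((fun t => χ t ω) '' T')) := by
  obtain ⟨K, hK, hT'⟩ := hT'
  exact Real.exp_le_exp.2 (csSup_le_csSup
    ((hK.bddAbove_image (hχ.cont ω).continuousOn).mono (Set.image_mono hT'))
    (hT.image _) (Set.image_mono h))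

lemma integrable_exp_sSup (hχ : IsChiAlpha P α χ) (hα : 0 < α) [IsProbabilityMeasure P]
    {T : Set (EuclideanSpace ℝ (Fin n))} (hT : T.Finite) (hTne : T.Nonempty) :
    Integrable (fun ω => rexp (sSup ((fun t => χ t ω) '' T))) P := by
  refine ⟨(hχ.measurable_exp_sSup hT).aestronglyMeasurable, ?_⟩
  obtain ⟨C, hC, h⟩ := hχ.exists_lintegral_exp_sSup_le hα hT.isCompact
  simp only [HasFiniteIntegral, ← ofReal_norm, Real.norm_eq_abs, Real.abs_exp]
  exact (h T le_rfl hT hTne).trans_lt hC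

lemma tendsto_HalphaSet_CrSet (hχ : IsChiAlpha P α χ) (hα : 0 < α) [IsProbabilityMeasure P]
    {rr : ℕ} {β : Type*} {F : Filter β} [F.IsCountablyGenerated] {N : β → ℕ} {γ : β → ℝ} {q : ℝ}
    (hq : 0 < q) (hγ : Tendsto γ F (𝓝[>] 0)) (hN : Tendsto (fun b => N b * γ b) F (𝓝 q))
    (hle : ∀ᶠ b in F, N b * γ b ≤ q) :
    Tendsto (fun b => HalphaSet P χ (CrSet n rr (N b) (γ b))) F
      (𝓝 (HalphaSet P χ (CubeSet n rr q))) := by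
  refine tendsto_integral_filter_of_dominated_convergence _
    (Eventually.of_forall fun b => (hχ.measurable_exp_sSup (finite_CrSet _ _)).aestronglyMeasurable)
    ?_ (hχ.integrable_exp_sSup_CubeSet (rr := rr) hα hq) (ae_of_all _ fun ω =>
      (tendsto_sSup_image_CrSet hq.le hγ hN hle (hχ.cont ω)).rexp)
  filter_upwards [hγ self_mem_nhdsWithin, hle] with b hb hb'
  refine ae_of_all _ fun ω => ?_
  rw [Real.norm_eq_abs, Real.abs_exp]
  exact hχ.exp_sSup_mono (CrSet_nonempty _ _) (CrSet_subset_CubeSet (le_of_lt hb) hb')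
    ⟨_, isCompact_CubeSet q, le_rfl⟩ ω

lemma HalphaSet_CrSet_le (hχ : IsChiAlpha P α χ) (hα : 0 < α) [IsProbabilityMeasure P]
    {rr l : ℕ} {γ q : ℝ} (hγ : 0 ≤ γ) (hq : 0 < q) (h : l * γ ≤ q) :
    HalphaSet P χ (CrSet n rr l γ) ≤ HalphaSet P χ (CubeSet n rr q) :=
  integral_mono (hχ.integrable_exp_sSup hα (finite_CrSet _ _) (CrSet_nonempty _ _))
    (hχ.integrable_exp_sSup_CubeSet hα hq)
    (hχ.exp_sSup_mono (CrSet_nonempty _ _) (CrSet_subset_CubeSet hγ h)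
      ⟨_, isCompact_CubeSet q, le_rfl⟩)

lemma HalphaSet_CubeSet_mono (hχ : IsChiAlpha P α χ) (hα : 0 < α) [IsProbabilityMeasure P]
    {rr : ℕ} {q q' : ℝ} (hq : 0 < q) (h : q ≤ q') :
    HalphaSet P χ (CubeSet n rr q) ≤ HalphaSet P χ (CubeSet n rr q') :=
  integral_mono (hχ.integrable_exp_sSup_CubeSet hα hq)
    (hχ.integrable_exp_sSup_CubeSet hα (hq.trans_le h))
    (hχ.exp_sSup_mono (CubeSet_nonempty hq.le) (CubeSet_subset_CubeSet h)
      ⟨_, isCompact_CubeSet q', le_rfl⟩)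

lemma HalphaSet_add_image (hχ : IsChiAlpha P α χ) (hα : 0 < α) [IsProbabilityMeasure P]
    (s : EuclideanSpace ℝ (Fin n)) {T : Set (EuclideanSpace ℝ (Fin n))}
    (hT : T.Finite) (hTne : T.Nonempty) :
    HalphaSet P χ ((s + ·) '' T) = HalphaSet P χ T := by
  have := hT.fintype
  have := hTne.to_subtype
  simp_rw [HalphaSet, Set.image_image, sSup_image']
  simpa using hχ.integral_exp_iSup_add hα (fun t : T => (t : EuclideanSpace ℝ (Fin n))) s 0

/-- Refining a grid inside all `l ^ rr` cells costs at most `l ^ rr` times the cost for one cell. -/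
lemma HalphaSet_refinement_le (hχ : IsChiAlpha P α χ) (hα : 0 < α) [IsProbabilityMeasure P]
    {rr l m k : ℕ} (hrr : rr ≤ n) (hl : 0 < l) (hk : 0 < k) (γ : ℝ) :
    HalphaSet P χ (CrSet n rr (l * m * k) (γ / k)) ≤ HalphaSet P χ (CrSet n rr (l * m) γ)
      + l ^ rr * (HalphaSet P χ (CrSet n rr (m * k) (γ / k)) - HalphaSet P χ (CrSet n rr m γ)) := by
  let fine (c : Fin rr → Fin l) := (cellCorner n (m * γ) c + ·) '' CrSet n rr (m * k) (γ / k)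
  let coarse (c : Fin rr → Fin l) := (cellCorner n (m * γ) c + ·) '' CrSet n rr m γ
  have hfine (c) : (fine c).Finite := (finite_CrSet _ _).image _
  have hcoarse (c) : (coarse c).Finite := (finite_CrSet _ _).image _
  have hfine_ne (c) : (fine c).Nonempty := (CrSet_nonempty _ _).image _
  have hcoarse_ne (c) : (coarse c).Nonempty := (CrSet_nonempty _ _).image _
  let M (T : Set (EuclideanSpace ℝ (Fin n))) (ω : Ω) := rexp (sSup ((fun t => χ t ω) '' T))
  have hpt (ω : Ω) : M (CrSet n rr (l * m * k) (γ / k)) ω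
      ≤ M (CrSet n rr (l * m) γ) ω + ∑ c, (M (fine c) ω - M (coarse c) ω) := by
    obtain ⟨t, ht, hmax⟩ := ((CrSet_nonempty (n := n) (rr := rr) (l * m * k) (γ / k)).image
      fun t => χ t ω).csSup_mem ((finite_CrSet _ _).image _)
    obtain ⟨c, hc⟩ := exists_mem_cellCorner_add_image_CrSet hl hk hrr ht
    have h1 : M (CrSet n rr (l * m * k) (γ / k)) ω ≤ M (fine c) ω := by
      simp only [M]
      rw [← hmax]
      exact Real.exp_le_exp.2 (le_csSup ((hfine c).image _).bddAbove ⟨t, hc, rfl⟩)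
    have h2 : M (coarse c) ω ≤ M (CrSet n rr (l * m) γ) ω :=
      hχ.exp_sSup_mono (hcoarse_ne c) (cellCorner_add_image_CrSet_subset m γ c)
        ⟨_, (finite_CrSet _ _).isCompact, le_rfl⟩ ω
    have h3 := Finset.single_le_sum (f := fun c => M (fine c) ω - M (coarse c) ω)
      (fun c _ => sub_nonneg.2 (hχ.exp_sSup_mono (hcoarse_ne c)
        (Set.image_mono (CrSet_subset_refinement m γ hk)) ⟨_, (hfine c).isCompact, le_rfl⟩ ω))
      (Finset.mem_univ c)
    linarith
  have hI {T : Set (EuclideanSpace ℝ (Fin n))} (hT : T.Finite) (hTne : T.Nonempty) :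
      Integrable (M T) P := hχ.integrable_exp_sSup hα hT hTne
  have hIc (c) : Integrable (fun ω => M (fine c) ω - M (coarse c) ω) P :=
    (hI (hfine c) (hfine_ne c)).sub (hI (hcoarse c) (hcoarse_ne c))
  have hint := integral_mono (hI (finite_CrSet _ _) (CrSet_nonempty _ _))
    ((hI (finite_CrSet _ _) (CrSet_nonempty _ _)).add
      (integrable_finsetSum Finset.univ fun c _ => hIc c)) hpt
  simp only [Pi.add_apply] at hint
  rw [integral_add (hI (finite_CrSet _ _) (CrSet_nonempty _ _))
    (integrable_finsetSum Finset.univ fun c _ => hIc c),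
    integral_finsetSum _ fun c _ => hIc c] at hint
  refine hint.trans_eq ?_
  have hc (c) : ∫ ω, (M (fine c) ω - M (coarse c) ω) ∂P
      = HalphaSet P χ (CrSet n rr (m * k) (γ / k)) - HalphaSet P χ (CrSet n rr m γ) := by
    rw [integral_sub (hI (hfine c) (hfine_ne c)) (hI (hcoarse c) (hcoarse_ne c)),
      ← hχ.HalphaSet_add_image hα (cellCorner n (m * γ) c) (finite_CrSet _ _) (CrSet_nonempty _ _),
      ← hχ.HalphaSet_add_image hα (cellCorner n (m * γ) c) (T := CrSet n rr m γ)
        (finite_CrSet _ _) (CrSet_nonempty _ _)]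
    rfl
  simp_rw [hc, Finset.sum_const, Finset.card_univ, Fintype.card_fun, Fintype.card_fin, nsmul_eq_mul]
  push_cast
  rfl

lemma HalphaSet_CubeSet_le (hχ : IsChiAlpha P α χ) (hα : 0 < α) [IsProbabilityMeasure P]
    {rr l m : ℕ} (hrr : rr ≤ n) (hl : 0 < l) (hm : 0 < m) {γ : ℝ} (hγ : 0 < γ) :
    HalphaSet P χ (CubeSet n rr (l * (m * γ))) ≤ HalphaSet P χ (CrSet n rr (l * m) γ)
      + l ^ rr * (HalphaSet P χ (CubeSet n rr (m * γ)) - HalphaSet P χ (CrSet n rr m γ)) := by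
  have hlim (N : ℕ) (hN : 0 < N) : Tendsto (fun j : ℕ => HalphaSet P χ
      (CrSet n rr (N * (j + 1)) (γ / (j + 1 : ℕ)))) atTop
      (𝓝 (HalphaSet P χ (CubeSet n rr (N * γ)))) := by
    have h (j : ℕ) : ((N * (j + 1) : ℕ) : ℝ) * (γ / (j + 1 : ℕ)) = N * γ := by
      push_cast
      field_simp
    exact hχ.tendsto_HalphaSet_CrSet hα (by positivity) (tendsto_const_div_succ hγ)
      (by simp only [h]; exact tendsto_const_nhds) (by simp only [h, le_refl, eventually_true])
  have h1 := hlim (l * m) (by positivity)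
  rw [Nat.cast_mul, mul_assoc] at h1
  exact le_of_tendsto_of_tendsto' h1
    ((((hlim m hm).sub_const _).const_mul ((l : ℝ) ^ rr)).const_add _)
    fun j => hχ.HalphaSet_refinement_le hα hrr hl j.succ_pos γ

end IsChiAlpha

/-- Bickel–Rosenblatt: with `χ_α` and `H_α` as defined (`1 ≤ r ≤ n`,
`0 < α ≤ 2`), if for every `γ > 0` the limit `H_α^{(r)}(γ) = lim_{l→∞} H_α(C^r(l,γ))/l^r`
exists and the limit `H_α^{(r)} = lim_{q→∞} H_α([0,q]^r)/q^r` exists, then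
`H_α^{(r)}(γ)/γ^r → H_α^{(r)}` as `γ → 0⁺`. -/
theorem stmt6 (n rr : ℕ) (hn : 1 ≤ n) (hrr1 : 1 ≤ rr) (hrrn : rr ≤ n)
    (α : ℝ) (hα0 : 0 < α) (hα2 : α ≤ 2)
    {Ω' : Type*} [MeasurableSpace Ω'] (P' : Measure Ω') [IsProbabilityMeasure P']
    (χ : EuclideanSpace ℝ (Fin n) → Ω' → ℝ) (hχ : IsChiAlpha P' α χ)
    (Hγ : ℝ → ℝ) (Hr : ℝ)
    (hHγ : ∀ γ : ℝ, 0 < γ →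
      Tendsto (fun l : ℕ => HalphaSet P' χ (CrSet n rr l γ) / (l : ℝ) ^ rr)
        atTop (𝓝 (Hγ γ)))
    (hHr : Tendsto (fun q : ℝ => HalphaSet P' χ (CubeSet n rr q) / q ^ rr)
      atTop (𝓝 Hr)) :
    Tendsto (fun γ : ℝ => Hγ γ / γ ^ rr) (𝓝[>] 0) (𝓝 Hr) := by
  refine tendsto_of_tendsto_of_tendsto_of_le_of_le' (g := fun γ : ℝ => Hr -
    (HalphaSet P' χ (CubeSet n rr 1) - HalphaSet P' χ (CrSet n rr ⌊1 * γ⁻¹⌋₊ γ))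
      / (⌊1 * γ⁻¹⌋₊ * γ) ^ rr) ?_ tendsto_const_nhds ?_ ?_
  · have h0 : Tendsto (fun γ : ℝ => (⌊1 * γ⁻¹⌋₊ : ℝ) * γ) (𝓝[>] 0) (𝓝 1) := by
      refine ((tendsto_nat_floor_mul_div_atTop zero_le_one).comp tendsto_inv_nhdsGT_zero).congr
        fun γ => ?_
      simp
    have h1 := hχ.tendsto_HalphaSet_CrSet (rr := rr) hα0 one_pos tendsto_id h0 (by
      filter_upwards [self_mem_nhdsWithin] with γ hγ
      have hγ : 0 < γ := hγ
      have := Nat.floor_le (inv_nonneg.2 hγ.le)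
      rw [one_mul]
      calc (⌊γ⁻¹⌋₊ : ℝ) * γ ≤ γ⁻¹ * γ := by gcongr
        _ = 1 := inv_mul_cancel₀ hγ.ne')
    simpa using ((h1.const_sub (HalphaSet P' χ (CubeSet n rr 1))).div (h0.pow rr)
      (by simp)).const_sub Hr
  · filter_upwards [Ioo_mem_nhdsGT (zero_lt_one (α := ℝ))] with γ hγ
    obtain ⟨hγ0, hγ1⟩ := hγ
    set m := ⌊1 * γ⁻¹⌋₊ with hm
    have hm0 : 0 < m := by
      rw [hm, one_mul]
      exact Nat.floor_pos.2 (one_le_inv₀ hγ0 |>.2 hγ1.le)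
    have hmγ : m * γ ≤ 1 := by
      have : (m : ℝ) ≤ γ⁻¹ := by
        rw [hm, one_mul]
        exact Nat.floor_le (inv_nonneg.2 hγ0.le)
      calc (m : ℝ) * γ ≤ γ⁻¹ * γ := by gcongr
        _ = 1 := inv_mul_cancel₀ hγ0.ne'
    have hmγ0 : 0 < m * γ := by positivity
    have hlimC : Tendsto (fun l : ℕ => HalphaSet P' χ (CubeSet n rr (l * (m * γ))) / (l : ℝ) ^ rr)
        atTop (𝓝 (Hr * (m * γ) ^ rr)) := by
      refine ((hHr.comp (tendsto_natCast_atTop_atTop.atTop_mul_const hmγ0)).mul_const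
        ((m * γ) ^ rr)).congr fun l => ?_
      simp only [Function.comp_apply, mul_pow (l : ℝ)]
      field_simp
    have hlimG : Tendsto (fun l : ℕ => HalphaSet P' χ (CrSet n rr (l * m) γ) / (l : ℝ) ^ rr)
        atTop (𝓝 (Hγ γ * m ^ rr)) := by
      refine (((hHγ γ hγ0).comp (tendsto_id.atTop_mul_const' hm0)).mul_const
        ((m : ℝ) ^ rr)).congr fun l => ?_
      simp only [Function.comp_apply, id, Nat.cast_mul, mul_pow (l : ℝ)]
      field_simp
    have hkey : Hr * (m * γ) ^ rr ≤ Hγ γ * m ^ rr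
        + (HalphaSet P' χ (CubeSet n rr 1) - HalphaSet P' χ (CrSet n rr m γ)) := by
      refine le_of_tendsto_of_tendsto hlimC (hlimG.add_const _) ?_
      filter_upwards [eventually_gt_atTop 0] with l hl
      have h1 := hχ.HalphaSet_CubeSet_le hα0 hrrn hl hm0 hγ0
      have h2 := hχ.HalphaSet_CubeSet_mono (rr := rr) hα0 hmγ0 hmγ
      have hl' : (0 : ℝ) < (l : ℝ) ^ rr := by positivity
      rw [div_le_iff₀ hl', add_mul, div_mul_cancel₀ _ hl'.ne']
      nlinarith
    have hp : 0 < (m * γ) ^ rr := by positivity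
    rw [sub_le_iff_le_add, ← mul_le_mul_iff_left₀ hp, add_mul, div_mul_cancel₀ _ hp.ne']
    refine hkey.trans_eq ?_
    rw [mul_pow]
    field_simp
  · filter_upwards [self_mem_nhdsWithin] with γ hγ
    have hγ : 0 < γ := hγ
    rw [div_le_iff₀ (by positivity)]
    refine le_of_tendsto_of_tendsto (hHγ γ hγ)
      ((hHr.comp (tendsto_natCast_atTop_atTop.atTop_mul_const hγ)).mul_const (γ ^ rr)) ?_
    filter_upwards [eventually_gt_atTop 0] with l hl
    have h := hχ.HalphaSet_CrSet_le (rr := rr) (l := l) hα0 hγ.le (by positivity) le_rfl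
    calc HalphaSet P' χ (CrSet n rr l γ) / (l : ℝ) ^ rr
        ≤ HalphaSet P' χ (CubeSet n rr (l * γ)) / (l : ℝ) ^ rr := by gcongr
      _ = _ := by
        simp only [Function.comp_apply, mul_pow]
        field_simp
end

section
/- Let r be a positive integer, 0 < α ≤ 2, c > 0 and z ∈ ℝ. For h ∈ (0,1) define θ_h := √(2r·log(1/h)) + (2r·log(1/h))^{−1/2}·[ z + (r/α − 1/2)·log log(1/h) + log( (2r)^{r/α − 1/2} c / √(2π) ) ]. Then lim_{h→0+} h^{−r} · θ_h^{2r/α} · Ψ(θ_h) = e^{−z}/c, where Ψ(u) = (2π)^{−1/2} u^{−1} e^{−u²/2}. -/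
open Real Filter
open scoped Topology

/-- The normalizing sequence
`θ_h = √(2r log(1/h)) + (2r log(1/h))^{−1/2} [z + (r/α − 1/2) log log(1/h)
  + log((2r)^{r/α−1/2} c / √(2π))]`. -/
noncomputable def theta (r : ℕ) (α c z : ℝ) (h : ℝ) : ℝ :=
  Real.sqrt (2 * r * Real.log (1 / h)) +
    (2 * r * Real.log (1 / h)) ^ (-(1/2) : ℝ) *
      (z + ((r : ℝ) / α - 1/2) * Real.log (Real.log (1 / h)) +
        Real.log ((2 * (r : ℝ)) ^ ((r : ℝ) / α - 1/2) * c / Real.sqrt (2 * Real.pi)))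

/-- `(a + k log T) / √T → 0` as `T → ∞`. -/
theorem tendsto_add_mul_log_div_sqrt (a k : ℝ) :
    Tendsto (fun T : ℝ => (a + k * Real.log T) / Real.sqrt T) atTop (𝓝 0) := by
  have h1 : Tendsto (fun T : ℝ => a / Real.sqrt T) atTop (𝓝 0) :=
    tendsto_const_nhds.div_atTop Real.tendsto_sqrt_atTop
  have h2 : Tendsto (fun T : ℝ => Real.log T / Real.sqrt T) atTop (𝓝 0) := by
    have h := (isLittleO_log_rpow_atTop (r := 1 / 2) (by norm_num)).tendsto_div_nhds_zero
    simpa only [Real.sqrt_eq_rpow] using h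
  have h3 := h1.add (h2.const_mul k)
  rw [mul_zero, add_zero] at h3
  exact h3.congr fun T => by ring

/-- The Gaussian tail factor at `√T + B / √T`, where `B = z + k log T + log (c / √(2π))`. -/
theorem exp_mul_rpow_mul_PsiFn {T k c z B : ℝ} (hT : 0 < T) (hc : 0 < c)
    (hB : B = z + k * Real.log T + Real.log (c / Real.sqrt (2 * Real.pi)))
    (hpos : 0 < 1 + B / Real.sqrt T / Real.sqrt T) :
    Real.exp (T / 2) * (Real.sqrt T + B / Real.sqrt T) ^ (2 * k + 1) *
        PsiFn (Real.sqrt T + B / Real.sqrt T) =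
      Real.exp (-z) / c * ((1 + B / Real.sqrt T / Real.sqrt T) ^ (2 * k) *
        Real.exp (-(B / Real.sqrt T) ^ 2 / 2)) := by
  have hs : 0 < Real.sqrt T := Real.sqrt_pos.2 hT
  have hsT : Real.sqrt T ^ 2 = T := Real.sq_sqrt hT.le
  have hp : 0 < Real.sqrt (2 * Real.pi) := by positivity
  have hθ : Real.sqrt T + B / Real.sqrt T =
      Real.sqrt T * (1 + B / Real.sqrt T / Real.sqrt T) := by field_simp
  have hθ0 : 0 < Real.sqrt T + B / Real.sqrt T := hθ ▸ mul_pos hs hpos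
  have hpow : (Real.sqrt T + B / Real.sqrt T) ^ (2 * k + 1) =
      Real.exp (k * Real.log T) * (1 + B / Real.sqrt T / Real.sqrt T) ^ (2 * k) *
        (Real.sqrt T + B / Real.sqrt T) := by
    rw [Real.rpow_add_one hθ0.ne']
    congr 1
    rw [hθ, Real.mul_rpow hs.le hpos.le, Real.rpow_def_of_pos hs, Real.log_sqrt hT.le]
    congr 2
    ring
  have hexp : Real.exp (-(Real.sqrt T + B / Real.sqrt T) ^ 2 / 2) =
      (Real.exp (T / 2))⁻¹ * (Real.exp (-z) * (Real.exp (k * Real.log T))⁻¹ *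
        (c / Real.sqrt (2 * Real.pi))⁻¹) * Real.exp (-(B / Real.sqrt T) ^ 2 / 2) := by
    rw [← Real.exp_log (show 0 < c / Real.sqrt (2 * Real.pi) by positivity)]
    simp only [← Real.exp_neg, ← Real.exp_add]
    congr 1
    have hm : Real.sqrt T * (B / Real.sqrt T) = B := by field_simp
    linear_combination (-1 / 2 : ℝ) * hsT - hm - hB
  have hnorm : (2 * Real.pi) ^ (-(1 / 2) : ℝ) = (Real.sqrt (2 * Real.pi))⁻¹ := by
    rw [Real.rpow_neg (by positivity), Real.sqrt_eq_rpow]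
  rw [PsiFn, stdGaussianPDF, hexp, hpow, hnorm]
  generalize Real.sqrt T + B / Real.sqrt T = θ at hθ0 ⊢
  generalize (1 + B / Real.sqrt T / Real.sqrt T) ^ (2 * k) = w
  field_simp

/-- The limit of the Gaussian tail factor in the variable `T = 2r log (1/h)`. -/
theorem tendsto_exp_mul_rpow_mul_PsiFn {c : ℝ} (k z : ℝ) (hc : 0 < c) :
    Tendsto (fun T : ℝ =>
        Real.exp (T / 2) *
          (Real.sqrt T + (z + k * Real.log T + Real.log (c / Real.sqrt (2 * Real.pi))) /
            Real.sqrt T) ^ (2 * k + 1) *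
          PsiFn (Real.sqrt T + (z + k * Real.log T + Real.log (c / Real.sqrt (2 * Real.pi))) /
            Real.sqrt T))
      atTop (𝓝 (Real.exp (-z) / c)) := by
  have hβ : Tendsto (fun T : ℝ =>
      (z + k * Real.log T + Real.log (c / Real.sqrt (2 * Real.pi))) / Real.sqrt T)
      atTop (𝓝 0) :=
    (tendsto_add_mul_log_div_sqrt (z + Real.log (c / Real.sqrt (2 * Real.pi))) k).congr
      fun T => by ring
  have hone := (hβ.div_atTop Real.tendsto_sqrt_atTop).const_add 1
  rw [add_zero] at hone
  have hlim := ((hone.rpow_const (p := 2 * k) (Or.inl one_ne_zero)).mul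
    (((hβ.pow 2).neg.div_const 2).rexp)).const_mul (Real.exp (-z) / c)
  simp only [Real.one_rpow, ne_eq, OfNat.ofNat_ne_zero, not_false_eq_true, zero_pow, neg_zero,
    zero_div, Real.exp_zero, mul_one] at hlim
  refine hlim.congr' ?_
  filter_upwards [eventually_gt_atTop 0, hone.eventually (lt_mem_nhds one_pos)] with T hT hpos
  exact (exp_mul_rpow_mul_PsiFn hT hc rfl hpos).symm

/-- `theta` expressed through `T = 2r log (1/h)`. -/
theorem theta_eq {r : ℕ} (hr : 1 ≤ r) (α : ℝ) {c : ℝ} (z : ℝ) (hc : 0 < c) {h T : ℝ}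
    (hT : T = 2 * r * Real.log (1 / h)) (hL : 0 < Real.log (1 / h)) :
    theta r α c z h = Real.sqrt T + (z + ((r : ℝ) / α - 1 / 2) * Real.log T +
      Real.log (c / Real.sqrt (2 * Real.pi))) / Real.sqrt T := by
  have hr0 : (0 : ℝ) < 2 * r := by positivity
  have hT0 : 0 < T := hT ▸ mul_pos hr0 hL
  have hlogT : Real.log T = Real.log (2 * r) + Real.log (Real.log (1 / h)) := by
    rw [hT, Real.log_mul hr0.ne' hL.ne']
  rw [theta, ← hT, Real.rpow_neg hT0.le, ← Real.sqrt_eq_rpow, hlogT, mul_div_assoc,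
    Real.log_mul (Real.rpow_pos_of_pos hr0 _).ne' (by positivity), Real.log_rpow hr0]
  ring

/-- for `r ≥ 1`, `0 < α ≤ 2`, `c > 0`, `z ∈ ℝ`, with `θ_h` as above,
`h^{−r} θ_h^{2r/α} Ψ(θ_h) → e^{−z}/c` as `h → 0⁺`. -/
theorem stmt13 (r : ℕ) (hr : 1 ≤ r) (α : ℝ) (hα0 : 0 < α) (hα2 : α ≤ 2)
    (c z : ℝ) (hc : 0 < c) :
    Tendsto (fun h : ℝ =>
        h ^ (-(r : ℝ)) * (theta r α c z h) ^ (2 * (r : ℝ) / α) * PsiFn (theta r α c z h))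
      (𝓝[>] 0) (𝓝 (Real.exp (-z) / c)) := by
  have hr0 : (0 : ℝ) < 2 * r := by positivity
  have hT : Tendsto (fun h : ℝ => 2 * (r : ℝ) * Real.log (1 / h)) (𝓝[>] 0) atTop := by
    simp only [one_div]
    exact (Real.tendsto_log_atTop.comp tendsto_inv_nhdsGT_zero).const_mul_atTop hr0
  refine ((tendsto_exp_mul_rpow_mul_PsiFn ((r : ℝ) / α - 1 / 2) z hc).comp hT).congr' ?_
  filter_upwards [hT.eventually_gt_atTop 0, self_mem_nhdsWithin] with h hTh hh
  have hh0 : 0 < h := hh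
  have hexp : Real.exp (2 * r * Real.log (1 / h) / 2) = h ^ (-(r : ℝ)) := by
    rw [Real.rpow_def_of_pos hh0, one_div, Real.log_inv]
    congr 1
    ring
  rw [Function.comp_apply, ← theta_eq hr α z hc rfl (pos_of_mul_pos_right hTh hr0.le), hexp]
  congr 3
  ring
end
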